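/- arXiv:2106.10096 — 11 statements merged into one kernel-verified Lean document; each statement's English description precedes it below -/
import Mathlib

section
/- Let G be a tree with edge lengths ℓ and with V_D = ∅ (standard conditions at all vertices). Then there exists a strictly increasing sequence (ω_n) of positive real numbers with ω_n → ∞ such that for every n one has det A_{ω_n}(G) = 0, the kernel of A_{ω_n}(G) is one-dimensional, and every nonzero vector x in the kernel of A_{ω_n}(G) satisfies x(v) ≠ 0 for every vertex v ∈ V. (This is the matrix form of the statement that every compact metric tree with standard vertex conditions admits an infinite strictly increasing sequence of Laplace eigenvalues of multiplicity one whose eigenfunctions do not vanish at any vertex.) -/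
open Matrix Filter Topology

attribute [local instance] Classical.propDecidable

/-- The secular matrix built from per-edge cosine values `c` and sine values `s`,
for a graph with initial/terminal vertex maps `ι`, `τ` and Dirichlet vertex set `VD`.
Rows and columns are indexed by `V ⊕ E × Bool`, where `(e, false)` plays the role of
`(e,0)` (initial endpoint data) and `(e, true)` of `(e,1)` (terminal endpoint data). -/
noncomputable def secMatrix {V E : Type} (ι τ : E → V) (VD : Set V)
    (c s : E → ℝ) : Matrix (V ⊕ E × Bool) (V ⊕ E × Bool) ℝ :=
  Matrix.of fun i j =>
    match i, j with
    | Sum.inl v, Sum.inl u =>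
        if v ∈ VD then (if u = v then (1 : ℝ) else 0) else 0
    | Sum.inl v, Sum.inr (f, b) =>
        if v ∈ VD then 0
        else if b then (if τ f = v then 1 else 0) else (if ι f = v then 1 else 0)
    | Sum.inr (e, b), Sum.inl u =>
        if b then (if u = ι e then s e else 0)
        else (if u = τ e then 1 else 0) + (if u = ι e then -(c e) else 0)
    | Sum.inr (e, b), Sum.inr (f, b') =>
        if b then
          (if f = e ∧ b' = false then c e else 0) + (if f = e ∧ b' = true then 1 else 0)
        else if f = e ∧ b' = false then s e else 0

/-- The secular matrix `A_ω(G, V_D)` of a metric graph with edge lengths `ℓ`. -/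
noncomputable def secA {V E : Type} (ι τ : E → V) (VD : Set V) (ℓ : E → ℝ) (ω : ℝ) :
    Matrix (V ⊕ E × Bool) (V ⊕ E × Bool) ℝ :=
  secMatrix ι τ VD (fun e => Real.cos (ℓ e * ω)) (fun e => Real.sin (ℓ e * ω))

/-- Two vertices are adjacent if some edge joins them (in either direction). -/
def GraphAdj {V E : Type} (ι τ : E → V) (u w : V) : Prop :=
  ∃ e : E, (ι e = u ∧ τ e = w) ∨ (ι e = w ∧ τ e = u)

/-- A graph is connected if any two vertices are joined by a walk. -/
def IsConnectedGraph {V E : Type} (ι τ : E → V) : Prop :=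
  ∀ u w : V, Relation.ReflTransGen (GraphAdj ι τ) u w

/-- The degree of a vertex: the number of edges incident to it. -/
noncomputable def graphDegree {V E : Type} [Fintype E] (ι τ : E → V) (v : V) : ℕ :=
  (Finset.univ.filter fun e => ι e = v ∨ τ e = v).card

section SecularMatrix

variable {V E : Type} [Fintype V] [Fintype E] (ι τ : E → V) (VD : Set V) (c s : E → ℝ)

lemma secMatrix_mulVec_dirichlet (x : V ⊕ E × Bool → ℝ) {v : V} (hv : v ∈ VD) :
    (secMatrix ι τ VD c s).mulVec x (Sum.inl v) = x (Sum.inl v) := by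
  simp [secMatrix, mulVec, dotProduct, hv, Fintype.sum_sum_type]

lemma secMatrix_mulVec_kirchhoff (x : V ⊕ E × Bool → ℝ) {v : V} (hv : v ∉ VD) :
    (secMatrix ι τ VD c s).mulVec x (Sum.inl v) =
      ∑ e, ((if ι e = v then x (Sum.inr (e, false)) else 0) +
        if τ e = v then x (Sum.inr (e, true)) else 0) := by
  simp [secMatrix, mulVec, dotProduct, hv, Fintype.sum_sum_type, Fintype.sum_prod_type, add_comm]

lemma secMatrix_mulVec_value (x : V ⊕ E × Bool → ℝ) (e : E) :
    (secMatrix ι τ VD c s).mulVec x (Sum.inr (e, false)) =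
      x (Sum.inl (τ e)) - c e * x (Sum.inl (ι e)) + s e * x (Sum.inr (e, false)) := by
  simp [secMatrix, mulVec, dotProduct, Fintype.sum_sum_type, Fintype.sum_prod_type, add_mul,
    Finset.sum_add_distrib, sub_eq_add_neg]

lemma secMatrix_mulVec_derivative (x : V ⊕ E × Bool → ℝ) (e : E) :
    (secMatrix ι τ VD c s).mulVec x (Sum.inr (e, true)) =
      s e * x (Sum.inl (ι e)) + c e * x (Sum.inr (e, false)) + x (Sum.inr (e, true)) := by
  simp [secMatrix, mulVec, dotProduct, Fintype.sum_sum_type, Fintype.sum_prod_type, add_mul,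
    Finset.sum_add_distrib, add_assoc]

lemma sum_secMatrix_mulVec_kirchhoff (x : V ⊕ E × Bool → ℝ) :
    ∑ v, (secMatrix ι τ ∅ c s).mulVec x (Sum.inl v) =
      ∑ e, (x (Sum.inr (e, false)) + x (Sum.inr (e, true))) := by
  simp only [secMatrix_mulVec_kirchhoff ι τ ∅ c s x (Set.notMem_empty _)]
  rw [Finset.sum_comm]
  simp [Finset.sum_add_distrib]

/-- Imposing a Dirichlet condition at `r` changes only the row of `r`. -/
lemma secMatrix_mulVec_singleton_of_ne (x : V ⊕ E × Bool → ℝ) (r : V) {i : V ⊕ E × Bool}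
    (hi : i ≠ Sum.inl r) :
    (secMatrix ι τ {r} c s).mulVec x i = (secMatrix ι τ ∅ c s).mulVec x i := by
  rcases i with v | ⟨e, _ | _⟩
  · rw [secMatrix_mulVec_kirchhoff _ _ _ _ _ _ (Set.notMem_empty v),
      secMatrix_mulVec_kirchhoff _ _ _ _ _ _ (by simpa using hi)]
  · simp only [secMatrix_mulVec_value]
  · simp only [secMatrix_mulVec_derivative]

variable {ι τ}

omit [Fintype V] [Fintype E] in
lemma IsConnectedGraph.eq_of_forall_edge {α : Type*} (hconn : IsConnectedGraph ι τ) {p : V → α}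
    (hp : ∀ e, p (τ e) = p (ι e)) (u w : V) : p u = p w := by
  induction hconn u w with
  | refl => rfl
  | tail _ h ih =>
    obtain ⟨e, ⟨rfl, rfl⟩ | ⟨rfl, rfl⟩⟩ := h
    · exact ih.trans (hp e).symm
    · exact ih.trans (hp e)

/-- On a tree every function on the edges is the difference of a vertex potential. -/
lemma IsConnectedGraph.exists_potential (hconn : IsConnectedGraph ι τ)
    (htree : Fintype.card E + 1 = Fintype.card V) (r : V) (g : E → ℝ) :
    ∃ p : V → ℝ, p r = 0 ∧ ∀ e, p (ι e) - p (τ e) = g e := by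
  let d : (V → ℝ) →ₗ[ℝ] ℝ × (E → ℝ) :=
    (LinearMap.proj r).prod (LinearMap.funLeft ℝ ℝ ι - LinearMap.funLeft ℝ ℝ τ)
  have hd : Function.Injective d := by
    rw [← LinearMap.ker_eq_bot, LinearMap.ker_eq_bot']
    intro p hp
    have hr : p r = 0 := congrArg Prod.fst hp
    have he : ∀ e, p (τ e) = p (ι e) := fun e =>
      (sub_eq_zero.1 (congrFun (congrArg Prod.snd hp) e)).symm
    exact funext fun v => (hconn.eq_of_forall_edge he v r).trans hr
  have hs : Function.Surjective d :=
    (LinearMap.injective_iff_surjective_of_finrank_eq_finrank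
      (by simp [← htree, add_comm])).1 hd
  obtain ⟨p, hp⟩ := hs (0, g)
  exact ⟨p, congrArg Prod.fst hp, fun e => congrFun (congrArg Prod.snd hp) e⟩

lemma det_secMatrix_singleton_one_zero_ne_zero (hconn : IsConnectedGraph ι τ)
    (htree : Fintype.card E + 1 = Fintype.card V) (r : V) :
    (secMatrix ι τ {r} 1 0).det ≠ 0 := by
  intro hdet
  obtain ⟨x, hx0, hx⟩ := exists_mulVec_eq_zero_iff.2 hdet
  apply hx0
  have hr : x (Sum.inl r) = 0 := by
    simpa [secMatrix_mulVec_dirichlet] using congrFun hx (Sum.inl r)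
  have hval : ∀ e, x (Sum.inl (τ e)) = x (Sum.inl (ι e)) := fun e => by
    simpa [secMatrix_mulVec_value, sub_eq_zero] using congrFun hx (Sum.inr (e, false))
  have hder : ∀ e, x (Sum.inr (e, true)) = -x (Sum.inr (e, false)) := fun e => by
    have := congrFun hx (Sum.inr (e, true))
    simp only [secMatrix_mulVec_derivative, Pi.one_apply, Pi.zero_apply] at this
    linarith
  have hV : ∀ v, x (Sum.inl v) = 0 := fun v =>
    (hconn.eq_of_forall_edge (p := fun v => x (Sum.inl v)) hval v r).trans hr
  obtain ⟨p, hpr, hp⟩ := hconn.exists_potential htree r fun e => x (Sum.inr (e, false))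
  have hsum : ∑ e, x (Sum.inr (e, false)) * x (Sum.inr (e, false)) = 0 := by
    have hflow : ∑ v, p v * (∑ e, ((if ι e = v then x (Sum.inr (e, false)) else 0) +
        if τ e = v then x (Sum.inr (e, true)) else 0)) = 0 := by
      refine Finset.sum_eq_zero fun v _ => ?_
      by_cases hv : v = r
      · rw [hv, hpr, zero_mul]
      · rw [← secMatrix_mulVec_kirchhoff ι τ {r} 1 0 x (by simpa using hv), hx, Pi.zero_apply,
          mul_zero]
    simp only [Finset.mul_sum] at hflow
    rw [Finset.sum_comm] at hflow
    rw [← hflow]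
    refine Finset.sum_congr rfl fun e _ => ?_
    simp only [mul_add, mul_ite, mul_zero, Finset.sum_add_distrib, Finset.sum_ite_eq,
      Finset.mem_univ, if_true, hder]
    linear_combination -x (Sum.inr (e, false)) * hp e
  have hE : ∀ e, x (Sum.inr (e, false)) = 0 := fun e =>
    mul_self_eq_zero.1
      ((Finset.sum_eq_zero_iff_of_nonneg fun e _ => mul_self_nonneg _).1 hsum e (Finset.mem_univ e))
  funext i
  rcases i with v | ⟨e, _ | _⟩
  · exact hV v
  · exact hE e
  · simp [hder, hE]

lemma secMatrix_mulVec_eq_smul {r : V} {c s : E → ℝ} (hdet : (secMatrix ι τ {r} c s).det ≠ 0)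
    {x z : V ⊕ E × Bool → ℝ} (hx : (secMatrix ι τ ∅ c s).mulVec x = 0)
    (hxr : x (Sum.inl r) = 1) (hz : (secMatrix ι τ ∅ c s).mulVec z = 0) :
    z = z (Sum.inl r) • x := by
  rw [← sub_eq_zero]
  refine eq_zero_of_mulVec_eq_zero hdet (funext fun i => ?_)
  by_cases hi : i = Sum.inl r
  · subst hi
    simp [secMatrix_mulVec_dirichlet, hxr]
  · rw [secMatrix_mulVec_singleton_of_ne _ _ _ _ _ _ hi, mulVec_sub, mulVec_smul, hx, hz]
    simp

end SecularMatrix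

section TorusMatrix

variable {V E : Type}

/-- The secular matrix as a function of the edge phases `θ e = ℓ e * ω`. -/
noncomputable def phaseMatrix (ι τ : E → V) (VD : Set V) (θ : E → ℝ) :
    Matrix (V ⊕ E × Bool) (V ⊕ E × Bool) ℝ :=
  secMatrix ι τ VD (fun e => Real.cos (θ e)) (fun e => Real.sin (θ e))

lemma continuous_phaseMatrix (ι τ : E → V) (VD : Set V) : Continuous (phaseMatrix ι τ VD) := by
  refine continuous_matrix fun i j => ?_
  rcases i with v | ⟨e, _ | _⟩ <;> rcases j with u | ⟨f, _ | _⟩ <;>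
    simp only [phaseMatrix, secMatrix, of_apply] <;> split_ifs <;> fun_prop

variable [Fintype V] [Fintype E] {ι τ : E → V}

/-- A multiple of the solution with all vertex conditions except the one at `r`; the scaling makes
it the constant function `1` at zero phases. -/
noncomputable def rootedSolution (ι τ : E → V) (r : V) (θ : E → ℝ) : V ⊕ E × Bool → ℝ :=
  (phaseMatrix ι τ {r} 0).det⁻¹ • cramer (phaseMatrix ι τ {r} θ) (Pi.single (Sum.inl r) 1)

lemma continuous_rootedSolution (ι τ : E → V) (r : V) : Continuous (rootedSolution ι τ r) := by
  have := (continuous_phaseMatrix ι τ {r}).matrix_cramer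
    (continuous_const (y := (Pi.single (Sum.inl r) 1 : V ⊕ E × Bool → ℝ)))
  unfold rootedSolution
  fun_prop

omit [Fintype V] [Fintype E] in
lemma phaseMatrix_zero (VD : Set V) : phaseMatrix ι τ VD 0 = secMatrix ι τ VD 1 0 := by
  simp only [phaseMatrix, Pi.zero_apply, Real.cos_zero, Real.sin_zero]
  rfl

lemma phaseMatrix_singleton_mulVec_rootedSolution (r : V) (θ : E → ℝ) :
    (phaseMatrix ι τ {r} θ).mulVec (rootedSolution ι τ r θ) =
      ((phaseMatrix ι τ {r} 0).det⁻¹ * (phaseMatrix ι τ {r} θ).det) •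
        Pi.single (Sum.inl r) 1 := by
  rw [rootedSolution, mulVec_smul, mulVec_cramer, smul_smul]

lemma phaseMatrix_mulVec_rootedSolution_of_ne (r : V) (θ : E → ℝ) {i : V ⊕ E × Bool}
    (hi : i ≠ Sum.inl r) :
    (phaseMatrix ι τ ∅ θ).mulVec (rootedSolution ι τ r θ) i = 0 := by
  rw [phaseMatrix, ← secMatrix_mulVec_singleton_of_ne _ _ _ _ _ r hi, ← phaseMatrix,
    phaseMatrix_singleton_mulVec_rootedSolution]
  simp [hi]

lemma rootedSolution_zero (hconn : IsConnectedGraph ι τ)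
    (htree : Fintype.card E + 1 = Fintype.card V) (r : V) :
    rootedSolution ι τ r 0 = Sum.elim (fun _ => 1) (fun _ => 0) := by
  have hdet := det_secMatrix_singleton_one_zero_ne_zero hconn htree r
  rw [← sub_eq_zero]
  refine eq_zero_of_mulVec_eq_zero hdet (funext fun i => ?_)
  rw [mulVec_sub, ← phaseMatrix_zero, phaseMatrix_singleton_mulVec_rootedSolution,
    inv_mul_cancel₀ (by rwa [phaseMatrix_zero]), phaseMatrix_zero]
  by_cases hi : i = Sum.inl r
  · subst hi
    simp [secMatrix_mulVec_dirichlet]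
  · rw [Pi.sub_apply, secMatrix_mulVec_singleton_of_ne _ _ _ _ _ _ hi]
    rcases i with v | ⟨e, _ | _⟩
    · rw [secMatrix_mulVec_kirchhoff _ _ _ _ _ _ (Set.notMem_empty v)]
      simp [hi]
    · simp [secMatrix_mulVec_value]
    · simp [secMatrix_mulVec_derivative]

/-- The Kirchhoff defect of the rooted solution at the root. -/
noncomputable def rootDefect (ι τ : E → V) (r : V) (θ : E → ℝ) : ℝ :=
  (phaseMatrix ι τ ∅ θ).mulVec (rootedSolution ι τ r θ) (Sum.inl r)

lemma continuous_rootDefect (ι τ : E → V) (r : V) : Continuous (rootDefect ι τ r) :=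
  (continuous_apply _).comp
    ((continuous_phaseMatrix ι τ ∅).matrix_mulVec (continuous_rootedSolution ι τ r))

lemma rootDefect_eq_sum (r : V) {θ : E → ℝ} (hcos : ∀ e, 0 < Real.cos (θ e)) :
    rootDefect ι τ r θ = -∑ e, Real.sin (θ e) *
      (rootedSolution ι τ r θ (Sum.inl (ι e)) -
        Real.sin (θ e) / (1 + Real.cos (θ e)) * rootedSolution ι τ r θ (Sum.inr (e, false))) := by
  have hsum : ∑ v, (phaseMatrix ι τ ∅ θ).mulVec (rootedSolution ι τ r θ) (Sum.inl v) = _ :=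
    sum_secMatrix_mulVec_kirchhoff ι τ _ _ _
  rw [Finset.sum_eq_single r
    (fun v _ hv => phaseMatrix_mulVec_rootedSolution_of_ne r θ (by simpa using hv))
    (by simp)] at hsum
  rw [rootDefect, hsum, ← Finset.sum_neg_distrib]
  refine Finset.sum_congr rfl fun e _ => ?_
  have hder := phaseMatrix_mulVec_rootedSolution_of_ne (ι := ι) (τ := τ) r θ
    (i := Sum.inr (e, true)) (by simp)
  rw [phaseMatrix, secMatrix_mulVec_derivative] at hder
  have hne : 1 + Real.cos (θ e) ≠ 0 := by linarith [hcos e]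
  field_simp
  linear_combination (1 + Real.cos (θ e)) * hder
    - rootedSolution ι τ r θ (Sum.inr (e, false)) * Real.sin_sq_add_cos_sq (θ e)

lemma eventually_rootDefect_sign (hconn : IsConnectedGraph ι τ)
    (htree : Fintype.card E + 1 = Fintype.card V) (r : V) :
    ∀ᶠ θ in 𝓝 (0 : E → ℝ), (phaseMatrix ι τ {r} θ).det ≠ 0 ∧
      (∀ v, 0 < rootedSolution ι τ r θ (Sum.inl v)) ∧
      ((∀ e, 0 ≤ θ e) → rootDefect ι τ r θ ≤ 0) ∧
      ((∀ e, θ e ≤ 0) → 0 ≤ rootDefect ι τ r θ) := by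
  have hsol := continuous_rootedSolution ι τ r
  have hcoord : ∀ i, ContinuousAt (fun θ => rootedSolution ι τ r θ i) 0 := fun i =>
    ((continuous_apply i).comp hsol).continuousAt
  have hdet : ∀ᶠ θ in 𝓝 (0 : E → ℝ), (phaseMatrix ι τ {r} θ).det ≠ 0 := by
    refine (continuous_phaseMatrix ι τ {r}).matrix_det.continuousAt.eventually_ne ?_
    rw [phaseMatrix_zero]
    exact det_secMatrix_singleton_one_zero_ne_zero hconn htree r
  have hpos : ∀ᶠ θ in 𝓝 (0 : E → ℝ), ∀ v, 0 < rootedSolution ι τ r θ (Sum.inl v) :=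
    eventually_all.2 fun v => (hcoord _).tendsto.eventually_const_lt
      (by simp [rootedSolution_zero hconn htree])
  have hedge : ∀ᶠ θ in 𝓝 (0 : E → ℝ), ∀ e, 0 < rootedSolution ι τ r θ (Sum.inl (ι e)) -
      Real.sin (θ e) / (1 + Real.cos (θ e)) * rootedSolution ι τ r θ (Sum.inr (e, false)) := by
    refine eventually_all.2 fun e => continuousAt_const.eventually_lt ?_ (by simp [rootedSolution_zero hconn htree])
    refine (hcoord _).sub (ContinuousAt.mul (ContinuousAt.div ?_ ?_ (by simp)) (hcoord _)) <;>
      exact Continuous.continuousAt (by fun_prop)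
  have hsmall : ∀ᶠ θ in 𝓝 (0 : E → ℝ), ∀ e, |θ e| < 1 :=
    eventually_all.2 fun e => ContinuousAt.eventually_lt (f := fun θ : E → ℝ => |θ e|)
      (Continuous.continuousAt (by fun_prop)) continuousAt_const (by simp)
  filter_upwards [hdet, hpos, hedge, hsmall] with θ h1 h2 h3 h4
  have hpi := Real.pi_gt_three
  have hcos : ∀ e, 0 < Real.cos (θ e) := fun e =>
    Real.cos_pos_of_mem_Ioo ⟨by linarith [(abs_lt.1 (h4 e)).1], by linarith [(abs_lt.1 (h4 e)).2]⟩
  refine ⟨h1, h2, fun hθ => ?_, fun hθ => ?_⟩ <;> rw [rootDefect_eq_sum r hcos]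
  · refine neg_nonpos.2 (Finset.sum_nonneg fun e _ => mul_nonneg ?_ (h3 e).le)
    exact Real.sin_nonneg_of_nonneg_of_le_pi (hθ e) (by linarith [(abs_lt.1 (h4 e)).2])
  · refine neg_nonneg.2 (Finset.sum_nonpos fun e _ => mul_nonpos_of_nonpos_of_nonneg ?_ (h3 e).le)
    exact Real.sin_nonpos_of_nonpos_of_neg_pi_le (hθ e) (by linarith [(abs_lt.1 (h4 e)).1])

end TorusMatrix

/-- Simultaneous recurrence: integer multiples of finitely many angles return jointly to any
neighbourhood of zero. -/
lemma frequently_forall_exists_abs_lt_angle_eq {E : Type*} [Finite E] (ℓ : E → ℝ) {δ : ℝ}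
    (hδ : 0 < δ) :
    ∃ᶠ n : ℕ in atTop, ∀ e, ∃ φ : ℝ, |φ| < δ ∧ (φ : Real.Angle) = (n * ℓ e : ℝ) := by
  have : Fact (0 < 2 * Real.pi) := ⟨Real.two_pi_pos⟩
  have : CompactSpace Real.Angle := AddCircle.compactSpace (2 * Real.pi)
  have hcluster := mapClusterPt_zero_atTop_nsmul (fun e => (ℓ e : Real.Angle))
  have hopen : IsOpen ((fun φ : ℝ => (φ : Real.Angle)) '' Metric.ball 0 δ) :=
    QuotientAddGroup.isOpenMap_coe _ Metric.isOpen_ball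
  have hev : ∀ᶠ α in 𝓝 (0 : E → Real.Angle), ∀ e, ∃ φ : ℝ, |φ| < δ ∧ (φ : Real.Angle) = α e := by
    refine eventually_all.2 fun e => ?_
    have hmem := (continuous_apply (A := fun _ : E => Real.Angle) e).continuousAt.preimage_mem_nhds
      (x := 0) (hopen.mem_nhds ⟨0, Metric.mem_ball_self hδ, Real.Angle.coe_zero⟩)
    filter_upwards [hmem] with α hα
    obtain ⟨φ, hφ, heq⟩ := hα
    exact ⟨φ, by simpa using hφ, heq⟩
  refine (hcluster.frequently hev).mono fun n hn e => ?_
  obtain ⟨φ, hφ, heq⟩ := hn e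
  exact ⟨φ, hφ, by rw [heq, Pi.smul_apply, ← Real.Angle.coe_nsmul, nsmul_eq_mul]⟩

/-- A tree has arbitrarily large simple eigenfrequencies whose eigenvectors vanish at no vertex. -/
lemma exists_simple_nonvanishing_frequency_gt {V E : Type} [Fintype V] [Fintype E]
    {ι τ : E → V} (hconn : IsConnectedGraph ι τ)
    (htree : Fintype.card E + 1 = Fintype.card V)
    {ℓ : E → ℝ} (hℓ : ∀ e, 0 < ℓ e) (N : ℝ) :
    ∃ ω > N, (secA ι τ (∅ : Set V) ℓ ω).det = 0 ∧
      Module.finrank ℝ (LinearMap.ker (Matrix.toLin' (secA ι τ (∅ : Set V) ℓ ω))) = 1 ∧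
      ∀ x : (V ⊕ E × Bool) → ℝ, (secA ι τ (∅ : Set V) ℓ ω).mulVec x = 0 → x ≠ 0 →
        ∀ v : V, x (Sum.inl v) ≠ 0 := by
  obtain ⟨r⟩ : Nonempty V := Fintype.card_pos_iff.1 (by omega)
  obtain ⟨δ, hδ, hball⟩ := Metric.eventually_nhds_iff.1 (eventually_rootDefect_sign hconn htree r)
  replace hball := fun (θ : E → ℝ) (hθ : ∀ e, |θ e| < δ) =>
    hball (y := θ) ((dist_pi_lt_iff hδ).2 fun e => by simpa using hθ e)
  obtain ⟨ε, hεδ, hε⟩ : ∃ ε : ℝ, (∀ e, ℓ e * ε < δ / 2) ∧ 0 < ε := by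
    have : ∀ᶠ ε in 𝓝 (0 : ℝ), ∀ e, ℓ e * ε < δ / 2 :=
      eventually_all.2 fun e => ContinuousAt.eventually_lt (f := fun ε : ℝ => ℓ e * ε)
        (by fun_prop) continuousAt_const (by simpa using hδ)
    exact ((this.filter_mono nhdsWithin_le_nhds).and self_mem_nhdsWithin).exists (f := 𝓝[>] 0)
  obtain ⟨η, hη, hηpos⟩ : ∃ η : ℝ, (∀ e, η < ℓ e * ε) ∧ 0 < η := by
    have : ∀ᶠ η in 𝓝 (0 : ℝ), ∀ e, η < ℓ e * ε :=
      eventually_all.2 fun e => eventually_lt_nhds (mul_pos (hℓ e) hε)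
    exact ((this.filter_mono nhdsWithin_le_nhds).and self_mem_nhdsWithin).exists (f := 𝓝[>] 0)
  obtain ⟨n, hn, hnN⟩ := ((frequently_forall_exists_abs_lt_angle_eq ℓ hηpos).and_eventually
    (tendsto_natCast_atTop_atTop.eventually_gt_atTop (N + ε))).exists
  choose φ hφ hφangle using hn
  have hbound : ∀ t ∈ Set.Icc (-ε) ε, ∀ e, |φ e + ℓ e * t| < δ := fun t ht e => by
    have h1 := abs_lt.1 (hφ e)
    have h2 := mul_le_mul_of_nonneg_left ht.1 (hℓ e).le
    have h3 := mul_le_mul_of_nonneg_left ht.2 (hℓ e).le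
    have h4 := hη e
    have h5 := hεδ e
    rw [abs_lt]
    constructor <;> linarith [h1.1, h1.2]
  have hcont : Continuous fun t : ℝ => rootDefect ι τ r fun e => φ e + ℓ e * t :=
    (continuous_rootDefect ι τ r).comp (by fun_prop)
  have hleft : 0 ≤ rootDefect ι τ r fun e => φ e + ℓ e * -ε :=
    (hball _ (hbound _ ⟨le_rfl, by linarith⟩)).2.2.2 fun e => by
      linarith [(abs_lt.1 (hφ e)).2, hη e]
  have hright : (rootDefect ι τ r fun e => φ e + ℓ e * ε) ≤ 0 :=
    (hball _ (hbound _ ⟨by linarith, le_rfl⟩)).2.2.1 fun e => by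
      linarith [(abs_lt.1 (hφ e)).1, hη e]
  obtain ⟨t, ht, hzero⟩ :=
    intermediate_value_Icc' (by linarith : -ε ≤ ε) hcont.continuousOn ⟨hright, hleft⟩
  set θ : E → ℝ := fun e => φ e + ℓ e * t with hθ
  have hangle : ∀ e, ((ℓ e * (n + t) : ℝ) : Real.Angle) = (θ e : Real.Angle) := fun e => by
    simp only [hθ, Real.Angle.coe_add, hφangle, mul_add, mul_comm]
  have hmat : secA ι τ ∅ ℓ (n + t) = phaseMatrix ι τ ∅ θ := by
    simp only [secA, phaseMatrix, ← Real.Angle.cos_coe, ← Real.Angle.sin_coe, hangle]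
  obtain ⟨hdet, hpos, -⟩ := hball θ (hbound t ht)
  have hker : (phaseMatrix ι τ ∅ θ).mulVec (rootedSolution ι τ r θ) = 0 := funext fun i => by
    by_cases hi : i = Sum.inl r
    · rw [hi]
      exact hzero
    · exact phaseMatrix_mulVec_rootedSolution_of_ne r θ hi
  set x := (rootedSolution ι τ r θ (Sum.inl r))⁻¹ • rootedSolution ι τ r θ with hx
  have hxker : (phaseMatrix ι τ ∅ θ).mulVec x = 0 := by rw [hx, mulVec_smul, hker, smul_zero]
  have hxr : x (Sum.inl r) = 1 := by simp [hx, (hpos r).ne']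
  have hxv : ∀ v, x (Sum.inl v) ≠ 0 := fun v => by simp [hx, (hpos r).ne', (hpos v).ne']
  have hx0 : x ≠ 0 := fun h => hxv r (by simp [h])
  have hspan : ∀ z, (phaseMatrix ι τ ∅ θ).mulVec z = 0 → z = z (Sum.inl r) • x := fun z hz =>
    secMatrix_mulVec_eq_smul hdet hxker hxr hz
  refine ⟨n + t, by linarith [ht.1], ?_⟩
  rw [hmat]
  refine ⟨exists_mulVec_eq_zero_iff.1 ⟨x, hx0, hxker⟩, ?_, fun z hz hz0 v hzv => ?_⟩
  · have : LinearMap.ker (Matrix.toLin' (phaseMatrix ι τ ∅ θ)) = ℝ ∙ x := by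
      ext z
      rw [LinearMap.mem_ker, toLin'_apply, Submodule.mem_span_singleton]
      refine ⟨fun hz => ⟨_, (hspan z hz).symm⟩, ?_⟩
      rintro ⟨a, rfl⟩
      rw [mulVec_smul, hxker, smul_zero]
    rw [this, finrank_span_singleton hx0]
  · rw [hspan z hz, Pi.smul_apply, smul_eq_mul, mul_eq_zero, or_iff_left (hxv v)] at hzv
    exact hz0 (by rw [hspan z hz, hzv, zero_smul])

/-- Every compact metric tree with standard conditions at all vertices admits an infinite
strictly increasing sequence of eigenfrequencies `ω_n → ∞` whose secular matrices are
singular with one-dimensional kernel, and every nonzero kernel vector is nonzero in all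
vertex coordinates. -/
theorem tree_generic_eigenfunctions {V E : Type} [Fintype V] [Fintype E]
    (ι τ : E → V) (hnl : ∀ e, ι e ≠ τ e)
    (hconn : IsConnectedGraph ι τ)
    (htree : Fintype.card E + 1 = Fintype.card V)
    (ℓ : E → ℝ) (hℓ : ∀ e, 0 < ℓ e) :
    ∃ ω : ℕ → ℝ, StrictMono ω ∧ (∀ n, 0 < ω n) ∧
      Tendsto ω atTop atTop ∧
      ∀ n : ℕ,
        (secA ι τ (∅ : Set V) ℓ (ω n)).det = 0 ∧
        Module.finrank ℝ
          (LinearMap.ker (Matrix.toLin' (secA ι τ (∅ : Set V) ℓ (ω n)))) = 1 ∧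
        ∀ x : (V ⊕ E × Bool) → ℝ,
          (secA ι τ (∅ : Set V) ℓ (ω n)).mulVec x = 0 → x ≠ 0 →
          ∀ v : V, x (Sum.inl v) ≠ 0 := by
  choose f hf hgood using exists_simple_nonvanishing_frequency_gt hconn htree hℓ
  let ω : ℕ → ℝ := fun n => Nat.rec (f 0) (fun _ a => f (a + 1)) n
  have hstep : ∀ n, ω n + 1 < ω (n + 1) := fun n => hf (ω n + 1)
  have hmono : StrictMono ω := strictMono_nat_of_lt_succ fun n => by linarith [hstep n]
  have hlarge : ∀ n : ℕ, (n : ℝ) < ω n := fun n => by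
    induction n with
    | zero => simpa using! hf 0
    | succ n ih =>
      push_cast
      linarith [hstep n]
  refine ⟨ω, hmono, fun n => (Nat.cast_nonneg n).trans_lt (hlarge n),
    tendsto_atTop_mono (fun n => (hlarge n).le) tendsto_natCast_atTop_atTop, fun n => ?_⟩
  cases n with
  | zero => exact hgood 0
  | succ n => exact hgood (ω n + 1)
end

section
/- Let G be connected with edge lengths ℓ, and let V_D ⊆ V be nonempty with every vertex in V_D of degree one. Then there exists a strictly increasing sequence (ω_n) of positive real numbers with ω_n → ∞ and, for each n, a nonzero vector x_n in the kernel of A_{ω_n}(G, V_D) such that for every edge e ∈ E the pair (x_n(ι(e)), x_n((e,0))) is not (0,0). (This is the matrix form of the statement that every compact connected metric graph with at least one Dirichlet vertex has an increasing sequence of eigenvalues whose eigenfunctions have full support, i.e. vanish identically on no edge.) -/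
open Matrix Filter Topology

attribute [local instance] Classical.propDecidable

/-- The quadratic form `∑ₑ wₑ (κₑ (p² + q²) - 2 p q)`, where `p` and `q` are the values of `y` at
the endpoints of `e`. For `κ = cos (ℓ ω)` and `w = 1 / sin (ℓ ω)` it is the energy, divided by `ω`,
of the solution of `-f'' = ω² f` with vertex values `y`. -/
noncomputable def edgeForm {V E : Type} [Fintype E] (ι τ : E → V) (κ w : E → ℝ) (y : V → ℝ) : ℝ :=
  ∑ e, w e * (κ e * (y (ι e) ^ 2 + y (τ e) ^ 2) - 2 * (y (ι e) * y (τ e)))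

theorem edgeForm_smul_weight {V E : Type} [Fintype E] (ι τ : E → V) (κ w : E → ℝ) (y : V → ℝ)
    (r : ℝ) : edgeForm ι τ κ (r • w) y = r * edgeForm ι τ κ w y := by
  simp only [edgeForm, Finset.mul_sum, Pi.smul_apply, smul_eq_mul, mul_assoc]

theorem edgeForm_smul {V E : Type} [Fintype E] (ι τ : E → V) (κ w : E → ℝ) (y : V → ℝ)
    (r : ℝ) : edgeForm ι τ κ w (r • y) = r ^ 2 * edgeForm ι τ κ w y := by
  simp only [edgeForm, Finset.mul_sum, Pi.smul_apply, smul_eq_mul]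
  exact Finset.sum_congr rfl fun e _ => by ring

theorem edgeForm_abs_le {V E : Type} [Fintype E] (ι τ : E → V) (κ w : E → ℝ) (hw : ∀ e, 0 ≤ w e)
    (y : V → ℝ) : edgeForm ι τ κ w (fun v => |y v|) ≤ edgeForm ι τ κ w y := by
  refine Finset.sum_le_sum fun e _ => mul_le_mul_of_nonneg_left ?_ (hw e)
  have := le_abs_self (y (ι e) * y (τ e))
  simp only [sq_abs, ← abs_mul]
  linarith

theorem continuous_edgeForm {V E : Type} [Fintype E] (ι τ : E → V) :
    Continuous fun p : ((E → ℝ) × (E → ℝ)) × (V → ℝ) => edgeForm ι τ p.1.1 p.1.2 p.2 := by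
  unfold edgeForm
  fun_prop

/-- Half the derivative of `edgeForm` at `y` in direction of the indicator function of `v`. -/
noncomputable def edgeFormGrad {V E : Type} [Fintype E] (ι τ : E → V) (κ w : E → ℝ) (y : V → ℝ)
    (v : V) : ℝ :=
  ∑ e, ((if ι e = v then w e * (κ e * y (ι e) - y (τ e)) else 0) +
    (if τ e = v then w e * (κ e * y (τ e) - y (ι e)) else 0))

theorem edgeFormGrad_eq_zero {V E : Type} [Fintype E] (ι τ : E → V) (κ w : E → ℝ)
    (VD : Set V) (hpsd : ∀ y : V → ℝ, (∀ v ∈ VD, y v = 0) → 0 ≤ edgeForm ι τ κ w y)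
    (z : V → ℝ) (hz : ∀ v ∈ VD, z v = 0) (hz0 : edgeForm ι τ κ w z = 0) (v : V) (hv : v ∉ VD) :
    edgeFormGrad ι τ κ w z v = 0 := by
  set d : V → ℝ := fun u => if u = v then 1 else 0 with hd
  have hexp : ∀ t : ℝ, edgeForm ι τ κ w (fun u => z u + t * d u) =
      edgeForm ι τ κ w d * (t * t) + (2 * edgeFormGrad ι τ κ w z v) * t + 0 := by
    intro t
    rw [← hz0]
    simp only [edgeForm, edgeFormGrad, Finset.mul_sum, Finset.sum_mul, ← Finset.sum_add_distrib]
    refine Finset.sum_congr rfl fun e _ => ?_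
    simp only [hd]
    split_ifs <;> ring
  have hdisc := discrim_le_zero fun t => (hexp t) ▸ hpsd _ (by
    intro u hu
    have : u ≠ v := fun h => hv (h ▸ hu)
    simp [hd, hz u hu, this])
  simp only [discrim] at hdisc
  nlinarith [sq_nonneg (edgeFormGrad ι τ κ w z v)]

/-- A vertex of degree one meets only one edge. -/
theorem eq_of_graphDegree_eq_one {V E : Type} [Fintype E] {ι τ : E → V} {v : V}
    (h : graphDegree ι τ v = 1) {e f : E} (he : ι e = v ∨ τ e = v) (hf : ι f = v ∨ τ f = v) :
    e = f := by
  obtain ⟨g, hg⟩ := Finset.card_eq_one.mp h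
  have h1 : e ∈ ({g} : Finset E) := hg ▸ by simpa using he
  have h2 : f ∈ ({g} : Finset E) := hg ▸ by simpa using hf
  rw [Finset.mem_singleton] at h1 h2
  rw [h1, h2]

theorem exists_edge_of_graphDegree_eq_one {V E : Type} [Fintype E] {ι τ : E → V} {v : V}
    (h : graphDegree ι τ v = 1) : ∃ e, ι e = v ∨ τ e = v := by
  obtain ⟨g, hg⟩ := Finset.card_eq_one.mp h
  exact ⟨g, by simpa using hg.ge (Finset.mem_singleton_self g)⟩

/-- A nonnegative critical point of `edgeForm` on the functions vanishing on `VD` is positive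
off `VD`. -/
theorem pos_of_edgeFormGrad_eq_zero {V E : Type} [Fintype E] {ι τ : E → V}
    (hconn : IsConnectedGraph ι τ) {κ w : E → ℝ} (hw : ∀ e, 0 < w e) {VD : Set V}
    (hdeg : ∀ v ∈ VD, graphDegree ι τ v = 1) {z : V → ℝ} (hnn : ∀ v, 0 ≤ z v) (hne : z ≠ 0)
    (hgrad : ∀ v ∉ VD, edgeFormGrad ι τ κ w z v = 0) (v : V) (hv : v ∉ VD) : 0 < z v := by
  refine (hnn v).lt_of_ne' fun hzv => hne ?_
  have key : ∀ u, u ∉ VD → z u = 0 → ∀ e, (ι e = u ∨ τ e = u) → z (ι e) = 0 ∧ z (τ e) = 0 := by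
    intro u hu hzu
    have hg := hgrad u hu
    have hterm : ∀ e, ((if ι e = u then w e * (κ e * z (ι e) - z (τ e)) else 0) +
        (if τ e = u then w e * (κ e * z (τ e) - z (ι e)) else 0)) =
        -((if ι e = u then w e * z (τ e) else 0) + (if τ e = u then w e * z (ι e) else 0)) := by
      intro e
      split_ifs with h1 h2 h2 <;> simp_all
    simp only [edgeFormGrad, hterm, Finset.sum_neg_distrib, neg_eq_zero] at hg
    have hpos : ∀ e, 0 ≤ (if ι e = u then w e * z (τ e) else 0) ∧
        0 ≤ (if τ e = u then w e * z (ι e) else 0) := fun e =>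
      ⟨by split_ifs <;> first | exact le_rfl | exact mul_nonneg (hw e).le (hnn _),
        by split_ifs <;> first | exact le_rfl | exact mul_nonneg (hw e).le (hnn _)⟩
    rw [Finset.sum_eq_zero_iff_of_nonneg fun e _ => add_nonneg (hpos e).1 (hpos e).2] at hg
    intro e he
    have h0 := hg e (Finset.mem_univ e)
    rw [add_eq_zero_iff_of_nonneg (hpos e).1 (hpos e).2] at h0
    rcases he with he | he
    · refine ⟨he ▸ hzu, ?_⟩
      simpa [he, (hw e).ne'] using h0.1
    · refine ⟨?_, he ▸ hzu⟩
      simpa [he, (hw e).ne'] using h0.2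
  have hall : ∀ u, z u = 0 ∧ ∀ e, (ι e = u ∨ τ e = u) → z (ι e) = 0 ∧ z (τ e) = 0 := by
    intro u
    induction hconn v u with
    | refl => exact ⟨hzv, key v hv hzv⟩
    | @tail b c _ hbc ih =>
      obtain ⟨e, he⟩ := hbc
      have heb : ι e = b ∨ τ e = b := by tauto
      have hec : ι e = c ∨ τ e = c := by tauto
      have hze := ih.2 e heb
      have hzc : z c = 0 := by
        rcases hec with h | h
        · exact h ▸ hze.1
        · exact h ▸ hze.2
      refine ⟨hzc, ?_⟩
      by_cases hc : c ∈ VD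
      · intro f hf
        rw [← eq_of_graphDegree_eq_one (hdeg c hc) hec hf]
        exact hze
      · exact key c hc hzc
  exact funext fun u => (hall u).1

/-- If two Dirichlet vertices are joined by an edge, this edge is the whole graph. -/
theorem eq_of_dirichlet_edge {V E : Type} [Fintype E] {ι τ : E → V}
    (hconn : IsConnectedGraph ι τ) {VD : Set V} (hdeg : ∀ v ∈ VD, graphDegree ι τ v = 1)
    {e : E} (hι : ι e ∈ VD) (hτ : τ e ∈ VD) : (∀ v, v ∈ VD) ∧ ∀ f, f = e := by
  have hall : ∀ v, v = ι e ∨ v = τ e := by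
    intro v
    induction hconn (ι e) v with
    | refl => exact Or.inl rfl
    | @tail b c _ hbc ih =>
      obtain ⟨f, hf⟩ := hbc
      have hfb : ι f = b ∨ τ f = b := by tauto
      have hfe : e = f := by
        rcases ih with rfl | rfl
        · exact eq_of_graphDegree_eq_one (hdeg _ hι) (Or.inl rfl) hfb
        · exact eq_of_graphDegree_eq_one (hdeg _ hτ) (Or.inr rfl) hfb
      subst hfe
      rcases hf with h | h
      · exact Or.inr h.2.symm
      · exact Or.inl h.1.symm
  refine ⟨fun v => ?_, fun f => ?_⟩
  · rcases hall v with rfl | rfl <;> assumption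
  · rcases hall (ι f) with h | h
    · exact eq_of_graphDegree_eq_one (hdeg _ hι) (Or.inl h) (Or.inl rfl)
    · exact eq_of_graphDegree_eq_one (hdeg _ hτ) (Or.inl h) (Or.inr rfl)

theorem secMatrix_mulVec_eq_zero_iff {V E : Type} [Fintype V] [Fintype E] (ι τ : E → V)
    (VD : Set V) (c s : E → ℝ) (x : V ⊕ E × Bool → ℝ) :
    (secMatrix ι τ VD c s).mulVec x = 0 ↔
      (∀ v ∈ VD, x (Sum.inl v) = 0) ∧
      (∀ v ∉ VD, ∑ e, ((if ι e = v then x (Sum.inr (e, false)) else 0) +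
        (if τ e = v then x (Sum.inr (e, true)) else 0)) = 0) ∧
      ∀ e, x (Sum.inl (τ e)) - c e * x (Sum.inl (ι e)) + s e * x (Sum.inr (e, false)) = 0 ∧
        s e * x (Sum.inl (ι e)) + c e * x (Sum.inr (e, false)) + x (Sum.inr (e, true)) = 0 := by
  have hD : ∀ v ∈ VD, (secMatrix ι τ VD c s).mulVec x (Sum.inl v) = x (Sum.inl v) := by
    intro v hv
    simp [secMatrix, mulVec, dotProduct, hv]
  have hN : ∀ v ∉ VD, (secMatrix ι τ VD c s).mulVec x (Sum.inl v) =
      ∑ e, ((if ι e = v then x (Sum.inr (e, false)) else 0) +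
        (if τ e = v then x (Sum.inr (e, true)) else 0)) := by
    intro v hv
    simp [secMatrix, mulVec, dotProduct, hv, Fintype.sum_prod_type, add_comm]
  have hf : ∀ e, (secMatrix ι τ VD c s).mulVec x (Sum.inr (e, false)) =
      x (Sum.inl (τ e)) - c e * x (Sum.inl (ι e)) + s e * x (Sum.inr (e, false)) := by
    intro e
    simp [secMatrix, mulVec, dotProduct, Fintype.sum_prod_type, add_mul, Finset.sum_add_distrib,
      sub_eq_add_neg]
  have ht : ∀ e, (secMatrix ι τ VD c s).mulVec x (Sum.inr (e, true)) =
      s e * x (Sum.inl (ι e)) + c e * x (Sum.inr (e, false)) + x (Sum.inr (e, true)) := by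
    intro e
    simp [secMatrix, mulVec, dotProduct, Fintype.sum_prod_type, add_mul, Finset.sum_add_distrib]
    ring
  constructor
  · intro h
    refine ⟨fun v hv => ?_, fun v hv => ?_, fun e => ⟨?_, ?_⟩⟩
    · rw [← hD v hv, h, Pi.zero_apply]
    · rw [← hN v hv, h, Pi.zero_apply]
    · rw [← hf e, h, Pi.zero_apply]
    · rw [← ht e, h, Pi.zero_apply]
  · rintro ⟨h1, h2, h3⟩
    funext i
    rcases i with v | ⟨e, _ | _⟩
    · by_cases hv : v ∈ VD
      · rw [hD v hv, h1 v hv, Pi.zero_apply]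
      · rw [hN v hv, h2 v hv, Pi.zero_apply]
    · rw [hf e, (h3 e).1, Pi.zero_apply]
    · rw [ht e, (h3 e).2, Pi.zero_apply]

/-- `ω` is an eigenfrequency with a fully supported eigenfunction. -/
def HasFullSupportKernel {V E : Type} [Fintype V] [Fintype E] (ι τ : E → V) (VD : Set V)
    (ℓ : E → ℝ) (ω : ℝ) : Prop :=
  ∃ x : (V ⊕ E × Bool) → ℝ, x ≠ 0 ∧ (secA ι τ VD ℓ ω).mulVec x = 0 ∧
    ∀ e : E, ¬ (x (Sum.inl (ι e)) = 0 ∧ x (Sum.inr (e, false)) = 0)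

/-- If the energy form at `ω` is positive semidefinite and degenerate, its null vector extends to
an eigenfunction of full support. -/
theorem hasFullSupportKernel_of_edgeForm {V E : Type} [Fintype V] [Fintype E] {ι τ : E → V}
    (hconn : IsConnectedGraph ι τ) {VD : Set V} (hdeg : ∀ v ∈ VD, graphDegree ι τ v = 1)
    (hDD : ∀ e, ι e ∈ VD → τ e ∉ VD) {ℓ : E → ℝ} {ω : ℝ} (hs : ∀ e, 0 < Real.sin (ℓ e * ω))
    (hpsd : ∀ y : V → ℝ, (∀ v ∈ VD, y v = 0) →
      0 ≤ edgeForm ι τ (fun e => Real.cos (ℓ e * ω)) (fun e => (Real.sin (ℓ e * ω))⁻¹) y)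
    {y : V → ℝ} (hyD : ∀ v ∈ VD, y v = 0) (hy : y ≠ 0)
    (hy0 : edgeForm ι τ (fun e => Real.cos (ℓ e * ω)) (fun e => (Real.sin (ℓ e * ω))⁻¹) y = 0) :
    HasFullSupportKernel ι τ VD ℓ ω := by
  set c : E → ℝ := fun e => Real.cos (ℓ e * ω) with hc
  set s : E → ℝ := fun e => Real.sin (ℓ e * ω) with hsd
  set w : E → ℝ := fun e => (Real.sin (ℓ e * ω))⁻¹ with hwd
  have hw : ∀ e, 0 < w e := fun e => inv_pos.mpr (hs e)
  have hsw : ∀ e, s e * w e = 1 := fun e => mul_inv_cancel₀ (hs e).ne'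
  have hcs : ∀ e, s e ^ 2 + c e ^ 2 = 1 := fun e => Real.sin_sq_add_cos_sq _
  set z : V → ℝ := fun v => |y v| with hzd
  have hzD : ∀ v ∈ VD, z v = 0 := fun v hv => by simp [hzd, hyD v hv]
  have hz0 : edgeForm ι τ c w z = 0 :=
    le_antisymm (hy0 ▸ edgeForm_abs_le ι τ c w (fun e => (hw e).le) y) (hpsd z hzD)
  have hgrad := edgeFormGrad_eq_zero ι τ c w VD hpsd z hzD hz0
  have hzne : z ≠ 0 := fun h => hy (funext fun v => abs_eq_zero.mp (congrFun h v))
  have hpos := pos_of_edgeFormGrad_eq_zero hconn hw hdeg (fun v => abs_nonneg _) hzne hgrad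
  refine ⟨Sum.elim z fun p => if p.2 then w p.1 * (c p.1 * z (τ p.1) - z (ι p.1))
    else w p.1 * (c p.1 * z (ι p.1) - z (τ p.1)), ?_, ?_, ?_⟩
  · exact fun h => hzne (funext fun v => congrFun h (Sum.inl v))
  · refine (secMatrix_mulVec_eq_zero_iff ι τ VD c s _).mpr ⟨hzD, ?_, ?_⟩
    · simpa [edgeFormGrad] using hgrad
    · intro e
      simp only [Sum.elim_inl, Sum.elim_inr, if_true, Bool.false_eq_true, if_false]
      constructor
      · linear_combination (c e * z (ι e) - z (τ e)) * hsw e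
      · linear_combination (w e * z (ι e)) * hcs e - s e * z (ι e) * hsw e
  · rintro e ⟨h1, h2⟩
    simp only [Sum.elim_inl, Sum.elim_inr, Bool.false_eq_true, if_false] at h1 h2
    by_cases hι : ι e ∈ VD
    · have := hpos (τ e) (hDD e hι)
      rw [h1, mul_eq_zero] at h2
      rcases h2 with h2 | h2
      · exact (hw e).ne' h2
      · linarith
    · exact (hpos _ hι).ne' h1

/-- Simultaneous approximation: there are arbitrarily large `t` for which all `ℓ e * t` are close to
multiples of `2π`. -/
theorem exists_simultaneous_recurrence {E : Type} [Fintype E] (ℓ : E → ℝ) {ε : ℝ} (hε : 0 < ε)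
    (T : ℝ) : ∃ t > T, ∃ k : E → ℤ, ∀ e, |ℓ e * t - k e * (2 * Real.pi)| < ε := by
  have : Fact (0 < 2 * Real.pi) := ⟨Real.two_pi_pos⟩
  let g : E → AddCircle (2 * Real.pi) := fun e => ((ℓ e : ℝ) : AddCircle (2 * Real.pi))
  have hfreq := (mapClusterPt_zero_atTop_nsmul g).frequently (Metric.ball_mem_nhds 0 hε)
  obtain ⟨n, hn, hnT⟩ := (hfreq.and_eventually
    ((tendsto_natCast_atTop_atTop (R := ℝ)).eventually_gt_atTop T)).exists
  refine ⟨n, hnT, fun e => round ((2 * Real.pi)⁻¹ * (ℓ e * n)), fun e => ?_⟩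
  rw [← AddCircle.norm_eq]
  have h1 := (norm_le_pi_norm (n • g) e).trans_lt (mem_ball_zero_iff.mp hn)
  have h2 : (n • g) e = ((ℓ e * n : ℝ) : AddCircle (2 * Real.pi)) := by
    simp [g, mul_comm (ℓ e), ← nsmul_eq_mul]
  rwa [h2] at h1

/-- The first parameter at which a family of functions on a compact set stops being positive. -/
theorem exists_first_zero {Y : Type*} [TopologicalSpace Y] {K : Set Y} (hK : IsCompact K)
    {a b : ℝ} (hab : a ≤ b) {G : ℝ × Y → ℝ} (hG : ContinuousOn G (Set.Icc a b ×ˢ K))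
    (ha : ∀ y ∈ K, 0 < G (a, y)) (hb : ∃ y ∈ K, G (b, y) ≤ 0) :
    ∃ r ∈ Set.Icc a b, (∀ y ∈ K, 0 ≤ G (r, y)) ∧ ∃ y ∈ K, G (r, y) = 0 := by
  obtain ⟨yb, hyb, hGb⟩ := hb
  have hcomp : IsCompact ((Set.Icc a b ×ˢ K) ∩ G ⁻¹' Set.Iic 0) := by
    obtain ⟨u, hu, hu'⟩ := continuousOn_iff_isClosed.mp hG (Set.Iic 0) isClosed_Iic
    rw [Set.inter_comm, hu', Set.inter_comm]
    exact (isCompact_Icc.prod hK).inter_right hu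
  obtain ⟨⟨r, y⟩, ⟨⟨hr, hy⟩, hle⟩, hmin⟩ := hcomp.exists_isMinOn
    ⟨(b, yb), ⟨⟨hab, le_rfl⟩, hyb⟩, hGb⟩ continuous_fst.continuousOn
  have hnn : ∀ y' ∈ K, 0 ≤ G (r, y') := by
    intro y' hy'
    by_contra! hneg
    have hcont : ContinuousOn (fun q => G (q, y')) (Set.Icc a r) :=
      hG.comp (by fun_prop) fun q hq => ⟨⟨hq.1, hq.2.trans hr.2⟩, hy'⟩
    obtain ⟨q, hq, hq0⟩ := intermediate_value_Icc' hr.1 hcont ⟨hneg.le, (ha y' hy').le⟩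
    have hrq : r ≤ q := hmin (show (q, y') ∈ _ from
      ⟨⟨⟨hq.1, hq.2.trans hr.2⟩, hy'⟩, hq0.le⟩)
    have : q = r := le_antisymm hq.2 hrq
    subst this
    exact hneg.ne hq0
  exact ⟨r, hr, hnn, y, hy, le_antisymm hle (hnn y hy)⟩

/-- Normalized functions on the vertices that vanish on `VD`. -/
def dirichletSphere {V : Type} [Fintype V] (VD : Set V) : Set (V → ℝ) :=
  {y | (∀ v ∈ VD, y v = 0) ∧ ‖y‖ = 1}

theorem isCompact_dirichletSphere {V : Type} [Fintype V] (VD : Set V) :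
    IsCompact (dirichletSphere VD) := by
  have h : dirichletSphere VD = Metric.sphere 0 1 ∩ ⋂ v ∈ VD, {y : V → ℝ | y v = 0} := by
    ext y
    simp [dirichletSphere, and_comm]
  rw [h]
  exact (isCompact_sphere 0 1).inter_right (isClosed_biInter fun v _ =>
    isClosed_eq (continuous_apply v) continuous_const)

theorem ne_zero_of_mem_dirichletSphere {V : Type} [Fintype V] {VD : Set V} {y : V → ℝ}
    (hy : y ∈ dirichletSphere VD) : y ≠ 0 :=
  norm_ne_zero_iff.mp (by rw [hy.2]; exact one_ne_zero)

/-- Positive definiteness of `edgeForm` is an open condition on the coefficients. -/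
theorem eventually_edgeForm_pos {V E : Type} [Fintype V] [Fintype E] (ι τ : E → V) (VD : Set V)
    (κ w : E → ℝ) (h : ∀ y ∈ dirichletSphere VD, 0 < edgeForm ι τ κ w y) :
    ∀ᶠ p : (E → ℝ) × (E → ℝ) in 𝓝 (κ, w), ∀ y ∈ dirichletSphere VD, 0 < edgeForm ι τ p.1 p.2 y :=
  (isCompact_dirichletSphere VD).eventually_forall_of_forall_eventually fun y hy =>
    (continuous_edgeForm ι τ).continuousAt.eventually (lt_mem_nhds (h y hy))

theorem edgeForm_one_pos {V E : Type} [Fintype V] [Fintype E] {ι τ : E → V}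
    (hconn : IsConnectedGraph ι τ) {VD : Set V} (hVD : VD.Nonempty) {w : E → ℝ}
    (hw : ∀ e, 0 < w e) {y : V → ℝ} (hy : y ∈ dirichletSphere VD) : 0 < edgeForm ι τ 1 w y := by
  have hterm : ∀ e, w e * ((1 : E → ℝ) e * (y (ι e) ^ 2 + y (τ e) ^ 2) - 2 * (y (ι e) * y (τ e))) =
      w e * (y (ι e) - y (τ e)) ^ 2 := fun e => by simp only [Pi.one_apply]; ring
  have hnn : ∀ e, 0 ≤ w e * (y (ι e) - y (τ e)) ^ 2 := fun e =>
    mul_nonneg (hw e).le (sq_nonneg _)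
  simp only [edgeForm, hterm]
  refine (Finset.sum_nonneg fun e _ => hnn e).lt_of_ne' fun h0 => ?_
  rw [Finset.sum_eq_zero_iff_of_nonneg fun e _ => hnn e] at h0
  have heq : ∀ e, y (ι e) = y (τ e) := fun e => by
    simpa [(hw e).ne', sub_eq_zero] using h0 e (Finset.mem_univ e)
  obtain ⟨v₀, hv₀⟩ := hVD
  refine ne_zero_of_mem_dirichletSphere hy (funext fun u => ?_)
  induction hconn v₀ u with
  | refl => exact hy.1 v₀ hv₀
  | tail _ hbc ih =>
    obtain ⟨e, ⟨rfl, rfl⟩ | ⟨rfl, rfl⟩⟩ := hbc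
    · rw [← heq e]; exact ih
    · rw [heq e]; exact ih

/-- At low frequency the energy form is positive definite. -/
theorem eventually_edgeForm_pos_nhdsGT_zero {V E : Type} [Fintype V] [Fintype E] {ι τ : E → V}
    (hconn : IsConnectedGraph ι τ) {VD : Set V} (hVD : VD.Nonempty) {ℓ : E → ℝ}
    (hℓ : ∀ e, 0 < ℓ e) :
    ∀ᶠ ω in 𝓝[>] (0 : ℝ), ∀ y ∈ dirichletSphere VD,
      0 < edgeForm ι τ (fun e => Real.cos (ℓ e * ω)) (fun e => (Real.sin (ℓ e * ω))⁻¹) y := by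
  have hopen := eventually_edgeForm_pos ι τ VD 1 (fun e => (ℓ e * Real.sinc (ℓ e * 0))⁻¹)
    fun y hy => edgeForm_one_pos hconn hVD (fun e => by simpa using hℓ e) hy
  have htend : Tendsto (fun ω : ℝ => ((fun e => Real.cos (ℓ e * ω) : E → ℝ),
      (fun e => (ℓ e * Real.sinc (ℓ e * ω))⁻¹ : E → ℝ))) (𝓝 0)
      (𝓝 ((1 : E → ℝ), fun e => (ℓ e * Real.sinc (ℓ e * 0))⁻¹)) := by
    refine Tendsto.prodMk_nhds (tendsto_pi_nhds.mpr fun e => ?_) (tendsto_pi_nhds.mpr fun e => ?_)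
    · have : Continuous fun ω : ℝ => Real.cos (ℓ e * ω) := by fun_prop
      simpa using this.tendsto 0
    · have : Continuous fun ω : ℝ => ℓ e * Real.sinc (ℓ e * ω) :=
        continuous_const.mul (Real.continuous_sinc.comp (by fun_prop))
      exact (this.tendsto 0).inv₀ (by simpa using (hℓ e).ne')
  filter_upwards [nhdsWithin_le_nhds (htend.eventually hopen), self_mem_nhdsWithin]
    with ω hω hpos y hy
  have hpos' : (0 : ℝ) < ω := hpos
  have h := hω y hy
  have hw : (fun e => (ℓ e * Real.sinc (ℓ e * ω))⁻¹ : E → ℝ) =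
      ω • fun e => (Real.sin (ℓ e * ω))⁻¹ := by
    funext e
    have := (hℓ e).ne'
    rw [Real.sinc_of_ne_zero (mul_ne_zero this hpos'.ne'), Pi.smul_apply, smul_eq_mul]
    field_simp
  rw [hw, edgeForm_smul_weight] at h
  exact pos_of_mul_pos_right h hpos'.le

/-- Just below `π / L`, with `L` the maximal edge length, the energy form is negative on the
indicator function of the non-Dirichlet vertices. -/
theorem eventually_edgeForm_indicator_neg {V E : Type} [Fintype V] [Fintype E] {ι τ : E → V}
    {VD : Set V} (hDD : ∀ e, ι e ∈ VD → τ e ∉ VD) {ℓ : E → ℝ} (hℓ : ∀ e, 0 < ℓ e) {m : E}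
    (hm : ∀ e, ℓ e ≤ ℓ m) :
    ∀ᶠ ω in 𝓝[<] (Real.pi / ℓ m),
      edgeForm ι τ (fun e => Real.cos (ℓ e * ω)) (fun e => (Real.sin (ℓ e * ω))⁻¹)
        (VDᶜ.indicator 1) < 0 := by
  set b := Real.pi / ℓ m with hb
  have hbpos : 0 < b := div_pos Real.pi_pos (hℓ m)
  have hmb : ℓ m * b = Real.pi := by rw [hb]; field_simp [(hℓ m).ne']
  set κ : E → ℝ := fun e => Real.cos (ℓ e * b)
  set w : E → ℝ := fun e => if ℓ e = ℓ m then 1 else 0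
  have hval : edgeForm ι τ κ w (VDᶜ.indicator 1) < 0 := by
    have hneg : ∀ e, ℓ e = ℓ m → w e * (κ e * ((VDᶜ.indicator 1 : V → ℝ) (ι e) ^ 2 +
        (VDᶜ.indicator 1 : V → ℝ) (τ e) ^ 2) -
        2 * ((VDᶜ.indicator 1 : V → ℝ) (ι e) * (VDᶜ.indicator 1 : V → ℝ) (τ e))) < 0 := by
      intro e he
      have hκ : κ e = -1 := by simp only [κ]; rw [he, hmb, Real.cos_pi]
      have hw : w e = 1 := if_pos he
      rw [hκ, hw]
      by_cases h1 : ι e ∈ VD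
      · simp [h1, hDD e h1]
      · by_cases h2 : τ e ∈ VD <;> simp [h1, h2]
        norm_num
    refine Finset.sum_neg' (fun e _ => ?_) ⟨m, Finset.mem_univ m, hneg m rfl⟩
    by_cases he : ℓ e = ℓ m
    · exact (hneg e he).le
    · simp [w, he]
  have htend : Tendsto (fun ω : ℝ => (((fun e => Real.cos (ℓ e * ω) : E → ℝ),
      (fun e => Real.sin (ℓ m * ω) * (Real.sin (ℓ e * ω))⁻¹ : E → ℝ)),
      (VDᶜ.indicator 1 : V → ℝ))) (𝓝[<] b) (𝓝 ((κ, w), VDᶜ.indicator 1)) := by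
    refine ((tendsto_pi_nhds.mpr fun e => ?_).prodMk_nhds
      (tendsto_pi_nhds.mpr fun e => ?_)).prodMk_nhds tendsto_const_nhds
    · have : Continuous fun ω : ℝ => Real.cos (ℓ e * ω) := by fun_prop
      exact (this.tendsto b).mono_left nhdsWithin_le_nhds
    · by_cases he : ℓ e = ℓ m
      · have hw : w e = 1 := if_pos he
        rw [hw]
        refine tendsto_const_nhds.congr' ?_
        filter_upwards [Ioo_mem_nhdsLT hbpos] with ω hω
        rw [he, mul_inv_cancel₀ (Real.sin_pos_of_pos_of_lt_pi (mul_pos (hℓ m) hω.1)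
          (hmb ▸ mul_lt_mul_of_pos_left hω.2 (hℓ m))).ne']
      · have hw : w e = 0 := if_neg he
        have hlt : ℓ e * b < Real.pi :=
          hmb ▸ mul_lt_mul_of_pos_right ((hm e).lt_of_ne he) hbpos
        have hc : ∀ f, Continuous fun ω : ℝ => Real.sin (ℓ f * ω) := fun f => by fun_prop
        have h := ((hc m).tendsto b).mul (((hc e).tendsto b).inv₀
          (Real.sin_pos_of_pos_of_lt_pi (mul_pos (hℓ e) hbpos) hlt).ne')
        rw [hmb, Real.sin_pi, zero_mul] at h
        rw [hw]
        exact h.mono_left nhdsWithin_le_nhds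
  have hev := ((continuous_edgeForm ι τ).tendsto _).comp htend |>.eventually (gt_mem_nhds hval)
  filter_upwards [hev, Ioo_mem_nhdsLT hbpos] with ω hω hmem
  have hsin : 0 < Real.sin (ℓ m * ω) := Real.sin_pos_of_pos_of_lt_pi (mul_pos (hℓ m) hmem.1)
    (hmb ▸ mul_lt_mul_of_pos_left hmem.2 (hℓ m))
  have h : Real.sin (ℓ m * ω) * edgeForm ι τ (fun e => Real.cos (ℓ e * ω))
      (fun e => (Real.sin (ℓ e * ω))⁻¹) (VDᶜ.indicator 1) < 0 := by
    rw [← edgeForm_smul_weight]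
    exact hω
  exact neg_of_mul_neg_right h hsin.le

/-- The phases `θ = ℓ ω` enter the energy form continuously as long as no sine vanishes. -/
theorem continuousAt_edgeForm_coeff {E : Type} {θ : E → ℝ} (hθ : ∀ e, Real.sin (θ e) ≠ 0) :
    ContinuousAt (fun θ : E → ℝ => ((fun e => Real.cos (θ e) : E → ℝ),
      (fun e => (Real.sin (θ e))⁻¹ : E → ℝ))) θ := by
  refine ContinuousAt.prodMk (continuousAt_pi.mpr fun e => ?_) (continuousAt_pi.mpr fun e => ?_)
  · exact (Real.continuous_cos.comp (continuous_apply e)).continuousAt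
  · exact (Real.continuous_sin.comp (continuous_apply e)).continuousAt.inv₀ (hθ e)

theorem exists_hasFullSupportKernel_gt {V E : Type} [Fintype V] [Fintype E] {ι τ : E → V}
    (hconn : IsConnectedGraph ι τ) {ℓ : E → ℝ} (hℓ : ∀ e, 0 < ℓ e) {VD : Set V}
    (hVD : VD.Nonempty) (hdeg : ∀ v ∈ VD, graphDegree ι τ v = 1)
    (hDD : ∀ e, ι e ∈ VD → τ e ∉ VD) (T : ℝ) :
    ∃ ω > T, HasFullSupportKernel ι τ VD ℓ ω := by
  obtain ⟨v₀, hv₀⟩ := hVD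
  obtain ⟨e₀, -⟩ := exists_edge_of_graphDegree_eq_one (hdeg v₀ hv₀)
  obtain ⟨m, -, hm⟩ := Finset.exists_max_image Finset.univ ℓ ⟨e₀, Finset.mem_univ e₀⟩
  replace hm : ∀ e, ℓ e ≤ ℓ m := fun e => hm e (Finset.mem_univ e)
  have hbpos : 0 < Real.pi / ℓ m := div_pos Real.pi_pos (hℓ m)
  obtain ⟨a, hapos, haπ, ha⟩ : ∃ a, 0 < a ∧ a < Real.pi / ℓ m ∧ ∀ y ∈ dirichletSphere VD,
      0 < edgeForm ι τ (fun e => Real.cos (ℓ e * a)) (fun e => (Real.sin (ℓ e * a))⁻¹) y := by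
    obtain ⟨a, ha, ha'⟩ := ((eventually_edgeForm_pos_nhdsGT_zero hconn ⟨v₀, hv₀⟩ hℓ).and
      (Ioo_mem_nhdsGT hbpos)).exists
    exact ⟨a, ha'.1, ha'.2, ha⟩
  obtain ⟨b, hb, hab, hbπ⟩ := ((eventually_edgeForm_indicator_neg hDD hℓ hm).and
    (Ioo_mem_nhdsLT haπ)).exists
  have hpos : ∀ e, 0 < ℓ e * a := fun e => mul_pos (hℓ e) hapos
  have hmon : ∀ e, ℓ e * a < ℓ e * b := fun e => mul_lt_mul_of_pos_left hab (hℓ e)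
  have hltπ : ∀ e, ℓ e * b < Real.pi := fun e =>
    (mul_le_mul_of_nonneg_right (hm e) (hapos.trans hab).le).trans_lt
      ((lt_div_iff₀' (hℓ m)).mp hbπ)
  have hshift : ∀ r : ℝ, Tendsto (fun η : E → ℝ => fun e => ℓ e * r + η e) (𝓝 0)
      (𝓝 fun e => ℓ e * r) := fun r => by
    have : Continuous fun η : E → ℝ => fun e => ℓ e * r + η e := by fun_prop
    simpa using this.tendsto 0
  have hcoeff : ∀ r, (∀ e, 0 < ℓ e * r) → (∀ e, ℓ e * r < Real.pi) →
      ContinuousAt (fun θ : E → ℝ => ((fun e => Real.cos (θ e) : E → ℝ),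
        (fun e => (Real.sin (θ e))⁻¹ : E → ℝ))) fun e => ℓ e * r := fun r h1 h2 =>
    continuousAt_edgeForm_coeff fun e => (Real.sin_pos_of_pos_of_lt_pi (h1 e) (h2 e)).ne'
  have hevA := ((hcoeff a hpos fun e => (hmon e).trans (hltπ e)).tendsto.comp (hshift a)).eventually
    (eventually_edgeForm_pos ι τ VD _ _ ha)
  have hevB := ((continuous_edgeForm ι τ).tendsto (((fun e => Real.cos (ℓ e * b)),
    (fun e => (Real.sin (ℓ e * b))⁻¹)), (VDᶜ.indicator 1 : V → ℝ))).comp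
    (((hcoeff b (fun e => (hpos e).trans (hmon e)) hltπ).tendsto.comp
      (hshift b)).prodMk_nhds tendsto_const_nhds) |>.eventually (gt_mem_nhds hb)
  have hevpos : ∀ᶠ η : E → ℝ in 𝓝 0, ∀ e, 0 < ℓ e * a + η e :=
    eventually_all.mpr fun e => (tendsto_pi_nhds.mp (hshift a) e).eventually (lt_mem_nhds (hpos e))
  have hevπ : ∀ᶠ η : E → ℝ in 𝓝 0, ∀ e, ℓ e * b + η e < Real.pi :=
    eventually_all.mpr fun e => (tendsto_pi_nhds.mp (hshift b) e).eventually (gt_mem_nhds (hltπ e))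
  obtain ⟨ε, hε, hball⟩ := Metric.eventually_nhds_iff_ball.mp
    (((hevA.and hevB).and hevpos).and hevπ)
  obtain ⟨t, htT, k, hk⟩ := exists_simultaneous_recurrence ℓ hε T
  set η : E → ℝ := fun e => ℓ e * t - k e * (2 * Real.pi) with hη
  obtain ⟨⟨⟨hA, hB⟩, hηpos⟩, hηπ⟩ := hball η
    (mem_ball_zero_iff.mpr ((pi_norm_lt_iff hε).mpr fun e => hk e))
  have hangle : ∀ r e, ℓ e * (r + t) = (ℓ e * r + η e) + k e * (2 * Real.pi) := fun r e => by
    simp only [hη]; ring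
  have hcos : ∀ r e, Real.cos (ℓ e * (r + t)) = Real.cos (ℓ e * r + η e) := fun r e => by
    rw [hangle, Real.cos_add_int_mul_two_pi]
  have hsin : ∀ r e, Real.sin (ℓ e * (r + t)) = Real.sin (ℓ e * r + η e) := fun r e => by
    rw [hangle, Real.sin_add_int_mul_two_pi]
  have hsinpos : ∀ r ∈ Set.Icc a b, ∀ e, 0 < Real.sin (ℓ e * r + η e) := fun r hr e =>
    Real.sin_pos_of_pos_of_lt_pi
      ((hηpos e).trans_le (by linarith [mul_le_mul_of_nonneg_left hr.1 (hℓ e).le]))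
      (lt_of_le_of_lt (by linarith [mul_le_mul_of_nonneg_left hr.2 (hℓ e).le]) (hηπ e))
  have hind : (VDᶜ.indicator 1 : V → ℝ) ∈ dirichletSphere VD := by
    obtain ⟨u, hu⟩ : ∃ u, u ∉ VD := by
      by_cases h : ι e₀ ∈ VD
      · exact ⟨_, hDD e₀ h⟩
      · exact ⟨_, h⟩
    refine ⟨fun v hv => by simp [hv], le_antisymm ?_ ?_⟩
    · refine (pi_norm_le_iff_of_nonneg zero_le_one).mpr fun v => ?_
      by_cases hv : v ∈ VD <;> simp [hv]
    · simpa [hu] using norm_le_pi_norm (VDᶜ.indicator 1 : V → ℝ) u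
  obtain ⟨r, hr, hnn, y, hy, hy0⟩ := exists_first_zero (isCompact_dirichletSphere VD) hab.le
    (G := fun p => edgeForm ι τ (fun e => Real.cos (ℓ e * p.1 + η e))
      (fun e => (Real.sin (ℓ e * p.1 + η e))⁻¹) p.2)
    (by
      rintro ⟨r, y⟩ hp
      have hθ : Continuous fun p : ℝ × (V → ℝ) => fun e => ℓ e * p.1 + η e := by fun_prop
      have h1 := (continuousAt_edgeForm_coeff fun e => (hsinpos r hp.1 e).ne').comp
        (f := fun p : ℝ × (V → ℝ) => fun e => ℓ e * p.1 + η e) (x := (r, y)) hθ.continuousAt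
      exact ((continuous_edgeForm ι τ).continuousAt.comp
        (h1.prodMk continuous_snd.continuousAt)).continuousWithinAt)
    hA ⟨_, hind, le_of_lt hB⟩
  refine ⟨r + t, by linarith [hapos.trans_le hr.1], ?_⟩
  simp only [← hcos, ← hsin] at hnn hy0 hsinpos
  refine hasFullSupportKernel_of_edgeForm hconn hdeg hDD (hsinpos r hr) (fun x hx => ?_) hy.1
    (ne_zero_of_mem_dirichletSphere hy) hy0
  rcases eq_or_ne x 0 with rfl | hx0
  · simp [edgeForm]
  · have hnx := norm_ne_zero_iff.mpr hx0
    have h := hnn (‖x‖⁻¹ • x) ⟨fun v hv => by simp [hx v hv], by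
      rw [norm_smul, norm_inv, norm_norm, inv_mul_cancel₀ hnx]⟩
    rw [edgeForm_smul] at h
    exact nonneg_of_mul_nonneg_right h (by positivity)

/-- The single edge with two Dirichlet endpoints. -/
theorem exists_hasFullSupportKernel_gt_of_dirichlet_edge {V E : Type} [Fintype V] [Fintype E]
    {ι τ : E → V} {ℓ : E → ℝ} (hℓ : ∀ e, 0 < ℓ e) {VD : Set V} (hall : ∀ v, v ∈ VD) {e : E}
    (he : ∀ f, f = e) (T : ℝ) : ∃ ω > T, HasFullSupportKernel ι τ VD ℓ ω := by
  obtain ⟨n, hn⟩ := exists_nat_gt (T / (Real.pi / ℓ e))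
  have hsin : Real.sin (ℓ e * (n * (Real.pi / ℓ e))) = 0 := by
    rw [show ℓ e * (n * (Real.pi / ℓ e)) = n * Real.pi by field_simp [(hℓ e).ne'],
      Real.sin_nat_mul_pi]
  refine ⟨n * (Real.pi / ℓ e), (div_lt_iff₀ (div_pos Real.pi_pos (hℓ e))).mp hn,
    Sum.elim 0 fun p => if p.2 then -Real.cos (ℓ e * (n * (Real.pi / ℓ e))) else 1, ?_, ?_, ?_⟩
  · exact fun h => one_ne_zero (α := ℝ) (by simpa using congrFun h (Sum.inr (e, false)))
  · refine (secMatrix_mulVec_eq_zero_iff ι τ VD _ _ _).mpr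
      ⟨fun _ _ => rfl, fun v hv => absurd (hall v) hv, fun f => ?_⟩
    rw [he f]
    simp [hsin]
  · simp

/-- Every compact connected metric graph with at least one Dirichlet vertex (all Dirichlet
vertices having degree one) admits a strictly increasing sequence of eigenfrequencies
`ω_n → ∞` with kernel vectors of the secular matrix that correspond to eigenfunctions of
full support: on every edge, value and rescaled derivative at the initial endpoint are
not both zero. -/
theorem dirichlet_full_support {V E : Type} [Fintype V] [Fintype E]
    (ι τ : E → V) (hnl : ∀ e, ι e ≠ τ e)
    (hconn : IsConnectedGraph ι τ)
    (ℓ : E → ℝ) (hℓ : ∀ e, 0 < ℓ e)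
    (VD : Set V) (hVD : VD.Nonempty)
    (hdeg : ∀ v ∈ VD, graphDegree ι τ v = 1) :
    ∃ ω : ℕ → ℝ, StrictMono ω ∧ (∀ n, 0 < ω n) ∧
      Tendsto ω atTop atTop ∧
      ∀ n : ℕ, ∃ x : (V ⊕ E × Bool) → ℝ, x ≠ 0 ∧
        (secA ι τ VD ℓ (ω n)).mulVec x = 0 ∧
        ∀ e : E, ¬ (x (Sum.inl (ι e)) = 0 ∧ x (Sum.inr (e, false)) = 0) := by
  have hgt : ∀ T, ∃ ω > T, HasFullSupportKernel ι τ VD ℓ ω := by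
    by_cases hDD : ∃ e, ι e ∈ VD ∧ τ e ∈ VD
    · obtain ⟨e, hι, hτ⟩ := hDD
      obtain ⟨hall, he⟩ := eq_of_dirichlet_edge hconn hdeg hι hτ
      exact exists_hasFullSupportKernel_gt_of_dirichlet_edge hℓ hall he
    · push Not at hDD
      exact exists_hasFullSupportKernel_gt hconn hℓ hVD hdeg hDD
  have hfreq : ∃ᶠ ω in atTop, 0 < ω ∧ HasFullSupportKernel ι τ VD ℓ ω :=
    frequently_atTop.mpr fun T => by
      obtain ⟨ω, hω, h⟩ := hgt (max T 0)
      exact ⟨ω, (le_max_left _ _).trans hω.le, (le_max_right _ _).trans_lt hω, h⟩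
  obtain ⟨u, hu, hgood⟩ := exists_seq_forall_of_frequently hfreq
  obtain ⟨φ, hφ, huφ⟩ := strictMono_subseq_of_tendsto_atTop hu
  exact ⟨u ∘ φ, huφ, fun n => (hgood _).1, hu.comp hφ.tendsto_atTop, fun n => (hgood _).2⟩
end

section
/- Let G be a tree with edge lengths ℓ, V_D = ∅, and let q : E → ℝ be an edgewise constant potential. Then there exists a strictly increasing sequence (ω_n) of real numbers with ω_n → ∞ and ω_n² > q(e) for all e and all n, and, for each n, a nonzero vector x_n in the kernel of A^q_{ω_n}(G) such that x_n(v) ≠ 0 for every vertex v ∈ V. (This is the matrix form of the statement that the Schrödinger operator −ψ'' + q_e ψ with standard conditions on a compact metric tree has an infinite sequence of eigenfunctions not vanishing at any vertex.) -/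
open Matrix Filter Topology

attribute [local instance] Classical.propDecidable

/-- The potential secular matrix `A^q_ω(G)` (standard conditions everywhere): defined like
`A_ω(G)` but with `cos (ℓ e * ω)`, `sin (ℓ e * ω)` replaced by
`cos (ℓ e * √(ω² - q e))`, `sin (ℓ e * √(ω² - q e))`. -/
noncomputable def secAq {V E : Type} (ι τ : E → V) (ℓ q : E → ℝ) (ω : ℝ) :
    Matrix (V ⊕ E × Bool) (V ⊕ E × Bool) ℝ :=
  secMatrix ι τ (∅ : Set V)
    (fun e => Real.cos (ℓ e * Real.sqrt (ω ^ 2 - q e)))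
    (fun e => Real.sin (ℓ e * Real.sqrt (ω ^ 2 - q e)))

theorem IsConnectedGraph.eq_of_edge_eq {V E : Type} {ι τ : E → V}
    (hconn : IsConnectedGraph ι τ) {f : V → ℝ} (hf : ∀ e, f (ι e) = f (τ e)) (u w : V) :
    f u = f w := by
  induction hconn u w with
  | refl => rfl
  | tail _ h ih =>
    obtain ⟨e, ⟨rfl, rfl⟩ | ⟨rfl, rfl⟩⟩ := h
    · exact ih.trans (hf e)
    · exact ih.trans (hf e).symm

section

variable {V E : Type} [Fintype V] [Fintype E] {ι τ : E → V}

theorem secMatrix_mulVec_inl (c s : E → ℝ) (x : V ⊕ E × Bool → ℝ) (v : V) :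
    (secMatrix ι τ ∅ c s).mulVec x (Sum.inl v) =
      ∑ e, ((if ι e = v then x (Sum.inr (e, false)) else 0) +
        (if τ e = v then x (Sum.inr (e, true)) else 0)) := by
  simp [mulVec, dotProduct, secMatrix, Fintype.sum_prod_type, ite_mul, add_comm]

theorem secMatrix_mulVec_inr_false (c s : E → ℝ) (x : V ⊕ E × Bool → ℝ) (e : E) :
    (secMatrix ι τ ∅ c s).mulVec x (Sum.inr (e, false)) =
      x (Sum.inl (τ e)) - c e * x (Sum.inl (ι e)) + s e * x (Sum.inr (e, false)) := by
  simp [mulVec, dotProduct, secMatrix, Fintype.sum_prod_type, add_mul, ite_mul,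
    Finset.sum_add_distrib]
  ring

theorem secMatrix_mulVec_inr_true (c s : E → ℝ) (x : V ⊕ E × Bool → ℝ) (e : E) :
    (secMatrix ι τ ∅ c s).mulVec x (Sum.inr (e, true)) =
      s e * x (Sum.inl (ι e)) + c e * x (Sum.inr (e, false)) + x (Sum.inr (e, true)) := by
  simp [mulVec, dotProduct, secMatrix, Fintype.sum_prod_type, add_mul, ite_mul,
    Finset.sum_add_distrib]
  ring

theorem sum_secMatrix_mulVec_inl (c s : E → ℝ) (x : V ⊕ E × Bool → ℝ) :
    ∑ v, (secMatrix ι τ ∅ c s).mulVec x (Sum.inl v) =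
      ∑ e, (x (Sum.inr (e, false)) + x (Sum.inr (e, true))) := by
  simp_rw [secMatrix_mulVec_inl]
  rw [Finset.sum_comm]
  simp [Finset.sum_add_distrib]

/-- On a connected graph, the coboundary map `ℝ^V → ℝ^E` has kernel the constants; on a tree
it is therefore onto. -/
theorem tree_coboundary_surjective (hconn : IsConnectedGraph ι τ)
    (htree : Fintype.card E + 1 = Fintype.card V) (g : E → ℝ) :
    ∃ f : V → ℝ, ∀ e, f (ι e) - f (τ e) = g e := by
  let D : (V → ℝ) →ₗ[ℝ] (E → ℝ) :=
    { toFun := fun f e => f (ι e) - f (τ e)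
      map_add' := fun f h => by ext e; simp; ring
      map_smul' := fun a f => by ext e; simp; ring }
  have hker : Module.finrank ℝ (LinearMap.ker D) ≤ 1 := by
    have hle : LinearMap.ker D ≤ Submodule.span ℝ {fun _ : V => (1 : ℝ)} := by
      intro f hf
      have hf' : ∀ e, f (ι e) = f (τ e) := fun e =>
        sub_eq_zero.1 (congrFun (LinearMap.mem_ker.1 hf) e)
      have hne : Nonempty V := Fintype.card_pos_iff.1 (by omega)
      obtain ⟨r⟩ := hne
      refine Submodule.mem_span_singleton.2 ⟨f r, ?_⟩
      ext v
      simpa using hconn.eq_of_edge_eq hf' r v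
    exact (Submodule.finrank_mono hle).trans ((finrank_span_le_card _).trans (by simp))
  have hrank := LinearMap.finrank_range_add_finrank_ker D
  have hV : Module.finrank ℝ (V → ℝ) = Fintype.card V := Module.finrank_fintype_fun_eq_card ℝ
  have hE : Module.finrank ℝ (E → ℝ) = Fintype.card E := Module.finrank_fintype_fun_eq_card ℝ
  have hle := Submodule.finrank_le (LinearMap.range D)
  have htop : LinearMap.range D = ⊤ := Submodule.eq_top_of_finrank_eq (by omega)
  obtain ⟨f, hf⟩ := LinearMap.range_eq_top.1 htop g
  exact ⟨f, fun e => congrFun hf e⟩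

/-- A tree carries no nonzero circulation. -/
theorem tree_circulation_eq_zero (hconn : IsConnectedGraph ι τ)
    (htree : Fintype.card E + 1 = Fintype.card V) {y : E → ℝ}
    (hy : ∀ v, ∑ e, ((if ι e = v then y e else 0) - (if τ e = v then y e else 0)) = 0) (e : E) :
    y e = 0 := by
  obtain ⟨f, hf⟩ := tree_coboundary_surjective hconn htree y
  have h : ∑ v, f v * ∑ e, ((if ι e = v then y e else 0) - (if τ e = v then y e else 0)) = 0 :=
    Finset.sum_eq_zero fun v _ => by rw [hy v, mul_zero]
  simp_rw [Finset.mul_sum] at h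
  rw [Finset.sum_comm] at h
  have h' : ∑ e, y e * y e = 0 := by
    rw [← h]
    refine Finset.sum_congr rfl fun e _ => ?_
    simp only [mul_sub, mul_ite, mul_zero, Finset.sum_sub_distrib, Finset.sum_ite_eq,
      Finset.mem_univ, if_true]
    rw [← sub_mul, hf]
  exact mul_self_eq_zero.1
    ((Finset.sum_eq_zero_iff_of_nonneg fun e _ => mul_self_nonneg (y e)).1 h' e (Finset.mem_univ e))

/-- At zero phases, a vector vanishing at `r` and satisfying all equations except possibly the one
at `r` vanishes. -/
theorem eq_zero_of_secMatrix_mulVec_eq_zero (hconn : IsConnectedGraph ι τ)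
    (htree : Fintype.card E + 1 = Fintype.card V) (r : V) {x : V ⊕ E × Bool → ℝ}
    (hx : ∀ i, i ≠ Sum.inl r →
      (secMatrix ι τ ∅ (fun _ => (1 : ℝ)) (fun _ => 0)).mulVec x i = 0)
    (hr : x (Sum.inl r) = 0) : x = 0 := by
  have h0 : ∀ e, x (Sum.inl (ι e)) = x (Sum.inl (τ e)) := fun e => by
    have := hx (Sum.inr (e, false)) (by simp)
    rw [secMatrix_mulVec_inr_false] at this
    linarith
  have h1 : ∀ e, x (Sum.inr (e, true)) = -x (Sum.inr (e, false)) := fun e => by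
    have := hx (Sum.inr (e, true)) (by simp)
    rw [secMatrix_mulVec_inr_true] at this
    linarith
  have hv : ∀ v, x (Sum.inl v) = 0 := fun v =>
    (hconn.eq_of_edge_eq (f := fun v => x (Sum.inl v)) h0 v r).trans hr
  have hrow : ∀ v, (secMatrix ι τ ∅ (fun _ => (1 : ℝ)) (fun _ => 0)).mulVec x (Sum.inl v) = 0 := by
    intro v
    by_cases hvr : v = r
    · have hsum := sum_secMatrix_mulVec_inl (ι := ι) (τ := τ)
        (fun _ => (1 : ℝ)) (fun _ => 0) x
      rw [Finset.sum_eq_single r (fun w _ hw => hx _ (by simpa using hw)) (by simp)] at hsum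
      rw [hvr, hsum]
      exact Finset.sum_eq_zero fun e _ => by rw [h1]; ring
    · exact hx _ (by simpa using hvr)
  have hy : ∀ e, x (Sum.inr (e, false)) = 0 := by
    refine tree_circulation_eq_zero (ι := ι) (τ := τ) hconn htree fun v => ?_
    refine Eq.trans ?_ (hrow v)
    rw [secMatrix_mulVec_inl]
    refine Finset.sum_congr rfl fun e _ => ?_
    rw [h1]
    split_ifs <;> ring
  ext i
  match i with
  | Sum.inl v => exact hv v
  | Sum.inr (e, false) => exact hy e
  | Sum.inr (e, true) => simp [h1, hy]

/-- Near zero phases there is a continuous family of vectors, positive on vertices, that satisfy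
all equations but the one at `r`, whose defect there has the sign opposite to the phases. -/
theorem exists_positive_family (hconn : IsConnectedGraph ι τ)
    (htree : Fintype.card E + 1 = Fintype.card V) (r : V) :
    ∃ z : (E → ℝ) → V ⊕ E × Bool → ℝ, Continuous z ∧ ∃ η > 0,
      ∀ θ : E → ℝ, (∀ e, |θ e| < η) →
        (∀ v, 0 < z θ (Sum.inl v)) ∧
        (∀ i, i ≠ Sum.inl r → (secMatrix ι τ ∅ (fun e => Real.cos (θ e))
          (fun e => Real.sin (θ e))).mulVec (z θ) i = 0) ∧
        ((∀ e, 0 ≤ θ e) → (secMatrix ι τ ∅ (fun e => Real.cos (θ e))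
          (fun e => Real.sin (θ e))).mulVec (z θ) (Sum.inl r) ≤ 0) ∧
        ((∀ e, θ e ≤ 0) → 0 ≤ (secMatrix ι τ ∅ (fun e => Real.cos (θ e))
          (fun e => Real.sin (θ e))).mulVec (z θ) (Sum.inl r)) := by
  set M : (E → ℝ) → Matrix (V ⊕ E × Bool) (V ⊕ E × Bool) ℝ := fun θ =>
    secMatrix ι τ ∅ (fun e => Real.cos (θ e)) (fun e => Real.sin (θ e)) with hM
  let b : V ⊕ E × Bool → ℝ := Pi.single (Sum.inl r) 1
  let B : (E → ℝ) → Matrix (V ⊕ E × Bool) (V ⊕ E × Bool) ℝ := fun θ =>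
    (M θ).updateRow (Sum.inl r) b
  have hMc : Continuous M := by
    refine continuous_matrix fun i j => ?_
    rcases i with v | ⟨e, _ | _⟩ <;> rcases j with u | ⟨f, _ | _⟩ <;>
      simp only [hM, secMatrix, Matrix.of_apply] <;> split_ifs <;> fun_prop
  have hBc : Continuous B := hMc.matrix_updateRow _ continuous_const
  have hBrow : ∀ θ x i, i ≠ Sum.inl r → (B θ).mulVec x i = (M θ).mulVec x i := by
    intro θ x i hi
    simp [mulVec, B, hi]
  have hBr : ∀ θ x, (B θ).mulVec x (Sum.inl r) = x (Sum.inl r) := by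
    intro θ x
    simp [mulVec, B, b]
  have hM0 : M 0 = secMatrix ι τ ∅ (fun _ => (1 : ℝ)) (fun _ => 0) := by simp [hM]
  have hinj : ∀ x, (B 0).mulVec x = 0 → x = 0 := by
    intro x hx
    refine eq_zero_of_secMatrix_mulVec_eq_zero hconn htree r (fun i hi => ?_) ?_
    · rw [← hM0, ← hBrow 0 x i hi, hx]; rfl
    · rw [← hBr 0 x, hx]; rfl
  have hdet : (B 0).det ≠ 0 := by
    intro h
    obtain ⟨x, hx0, hx⟩ := Matrix.exists_mulVec_eq_zero_iff.2 h
    exact hx0 (hinj x hx)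
  let z : (E → ℝ) → V ⊕ E × Bool → ℝ := fun θ => (B 0).det⁻¹ • (B θ).cramer b
  have hcr : Continuous fun θ => (B θ).cramer b := hBc.matrix_cramer continuous_const
  have hzc : Continuous z :=
    continuous_pi fun i => continuous_const.mul ((continuous_apply i).comp hcr)
  have hBz : ∀ θ, (B θ).mulVec (z θ) = ((B 0).det⁻¹ * (B θ).det) • b := by
    intro θ
    simp only [z]
    rw [Matrix.mulVec_smul, Matrix.mulVec_cramer, smul_smul]
  have hMz : ∀ θ i, i ≠ Sum.inl r → (M θ).mulVec (z θ) i = 0 := by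
    intro θ i hi
    rw [← hBrow θ _ i hi, hBz]
    simp [b, hi]
  have hz0 : z 0 = Sum.elim (fun _ => 1) (fun _ => 0) := by
    rw [← sub_eq_zero]
    refine hinj _ ?_
    rw [Matrix.mulVec_sub, hBz, inv_mul_cancel₀ hdet, one_smul, sub_eq_zero]
    ext i
    by_cases hi : i = Sum.inl r
    · subst hi
      rw [hBr]; simp [b]
    · rw [hBrow _ _ _ hi, hM0]
      match i with
      | Sum.inl v => rw [secMatrix_mulVec_inl]; simp [b, hi]
      | Sum.inr (e, false) => rw [secMatrix_mulVec_inr_false]; simp [b]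
      | Sum.inr (e, true) => rw [secMatrix_mulVec_inr_true]; simp [b]
  have hev : ∀ᶠ θ in 𝓝 (0 : E → ℝ), (∀ v, 1 / 2 < z θ (Sum.inl v)) ∧
      (∀ e, |z θ (Sum.inr (e, false))| < 1 / 2) ∧ ∀ e, 0 < Real.cos (θ e) := by
    refine Filter.Eventually.and ?_ (Filter.Eventually.and ?_ ?_)
    · refine Filter.eventually_all.2 fun v => ?_
      have : ContinuousAt (fun θ => z θ (Sum.inl v)) 0 :=
        ((continuous_apply _).comp hzc).continuousAt
      exact this.eventually (lt_mem_nhds (by norm_num [hz0]))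
    · refine Filter.eventually_all.2 fun e => ?_
      have : ContinuousAt (fun θ => |z θ (Sum.inr (e, false))|) 0 :=
        ((continuous_apply _).comp hzc).abs.continuousAt
      exact this.eventually (gt_mem_nhds (by norm_num [hz0]))
    · refine Filter.eventually_all.2 fun e => ?_
      have : ContinuousAt (fun θ : E → ℝ => Real.cos (θ e)) 0 :=
        (Real.continuous_cos.comp (continuous_apply e)).continuousAt
      exact this.eventually (lt_mem_nhds (by simp))
  obtain ⟨η, hη, hball⟩ := Metric.eventually_nhds_iff.1 hev
  refine ⟨z, hzc, min η Real.pi, lt_min hη Real.pi_pos, fun θ hθ => ?_⟩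
  obtain ⟨hzv, hze, hcos⟩ := hball (y := θ) (by
    rw [dist_zero_right, pi_norm_lt_iff hη]
    exact fun e => (hθ e).trans_le (min_le_left _ _))
  have hsum := sum_secMatrix_mulVec_inl (ι := ι) (τ := τ)
    (fun e => Real.cos (θ e)) (fun e => Real.sin (θ e)) (z θ)
  rw [Finset.sum_eq_single r (fun w _ hw => hMz θ _ (by simpa using hw)) (by simp)] at hsum
  have hedge : ∀ e, z θ (Sum.inr (e, true)) =
      -(Real.sin (θ e) * z θ (Sum.inl (ι e))) - Real.cos (θ e) * z θ (Sum.inr (e, false)) := by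
    intro e
    have := hMz θ (Sum.inr (e, true)) (by simp)
    simp only [hM] at this
    rw [secMatrix_mulVec_inr_true] at this
    linarith
  have hbound : ∀ e, |(1 - Real.cos (θ e)) * z θ (Sum.inr (e, false))| ≤
      |Real.sin (θ e)| * (1 / 2) := by
    intro e
    rw [abs_mul]
    refine mul_le_mul ?_ (hze e).le (abs_nonneg _) (abs_nonneg _)
    rw [abs_of_nonneg (by linarith [Real.cos_le_one (θ e)])]
    have h1 := Real.sin_sq_add_cos_sq (θ e)
    have h2 := Real.abs_sin_le_one (θ e)
    have h3 := abs_nonneg (Real.sin (θ e))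
    rw [← sq_abs (Real.sin (θ e))] at h1
    nlinarith [hcos e, Real.cos_le_one (θ e)]
  have hpi : ∀ e, |θ e| < Real.pi := fun e => (hθ e).trans_le (min_le_right _ _)
  refine ⟨fun v => by linarith [hzv v], hMz θ, fun hpos => ?_, fun hneg => ?_⟩
  · rw [hsum]
    refine Finset.sum_nonpos fun e _ => ?_
    have hs := Real.sin_nonneg_of_nonneg_of_le_pi (hpos e) (abs_lt.1 (hpi e)).2.le
    have hb := hbound e
    rw [abs_of_nonneg hs] at hb
    rw [hedge]
    nlinarith [(abs_le.1 hb).2, hzv (ι e)]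
  · rw [hsum]
    refine Finset.sum_nonneg fun e _ => ?_
    have hs := Real.sin_nonpos_of_nonpos_of_neg_pi_le (hneg e) (abs_lt.1 (hpi e)).1.le
    have hb := hbound e
    rw [abs_of_nonpos hs] at hb
    rw [hedge]
    nlinarith [(abs_le.1 hb).1, hzv (ι e)]

end

/-- Simultaneous recurrence: arbitrarily large integers `n` bring every `ℓ e * n` close to
`2π ℤ`. -/
theorem exists_nat_forall_near_two_pi {E : Type} [Fintype E] (ℓ : E → ℝ) {ε : ℝ} (hε : 0 < ε)
    (N : ℕ) : ∃ n ≥ N, ∃ m : E → ℤ, ∀ e, |ℓ e * n - m e * (2 * Real.pi)| < ε := by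
  have : Fact (0 < 2 * Real.pi) := ⟨Real.two_pi_pos⟩
  have h := mapClusterPt_zero_atTop_nsmul (G := E → AddCircle (2 * Real.pi)) fun e => ↑(ℓ e)
  obtain ⟨n, hn, hmem⟩ := Filter.frequently_atTop.1 (h.frequently (Metric.ball_mem_nhds 0 hε)) N
  refine ⟨n, hn, fun e => round ((2 * Real.pi)⁻¹ * (ℓ e * n)), fun e => ?_⟩
  rw [← AddCircle.norm_eq]
  rw [dist_zero_right, pi_norm_lt_iff hε] at hmem
  rw [mul_comm (ℓ e), ← nsmul_eq_mul, AddCircle.coe_nsmul]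
  exact hmem e

theorem tendsto_sqrt_sq_sub_sub_self (q : ℝ) :
    Tendsto (fun ω : ℝ => √(ω ^ 2 - q) - ω) atTop (𝓝 0) := by
  have hlim : Tendsto (fun ω : ℝ => |q| / ω) atTop (𝓝 0) := tendsto_const_nhds.div_atTop tendsto_id
  refine squeeze_zero_norm' ?_ hlim
  filter_upwards [eventually_gt_atTop 0, eventually_ge_atTop (|q| + 1)] with ω h0 h1
  have hq : 0 ≤ ω ^ 2 - q := by nlinarith [le_abs_self q, abs_nonneg q]
  have hs := Real.sq_sqrt hq
  have hs0 := Real.sqrt_nonneg (ω ^ 2 - q)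
  rw [Real.norm_eq_abs, le_div_iff₀ h0]
  have hprod : |√(ω ^ 2 - q) - ω| * (√(ω ^ 2 - q) + ω) = |q| := by
    rw [← abs_of_nonneg (add_nonneg hs0 h0.le), ← abs_mul, ← abs_neg q]
    congr 1
    linear_combination hs
  nlinarith [abs_nonneg (√(ω ^ 2 - q) - ω)]

theorem exists_strictMono_tendsto_of_forall_exists_gt {p : ℝ → Prop} (h : ∀ a, ∃ b > a, p b) :
    ∃ u : ℕ → ℝ, StrictMono u ∧ Tendsto u atTop atTop ∧ ∀ n, p (u n) := by
  choose f hf hp using h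
  let v : ℕ → ℝ := fun n => Nat.rec 0 (fun k a => f (max a k)) n
  have hv : ∀ n, v (n + 1) = f (max (v n) n) := fun _ => rfl
  have hlt : ∀ n, max (v n) n < v (n + 1) := fun n => by rw [hv]; exact hf _
  refine ⟨fun n => v (n + 1), strictMono_nat_of_lt_succ fun n =>
    (le_max_left _ _).trans_lt (hlt (n + 1)), ?_, fun n => by simp only [hv]; exact hp _⟩
  exact tendsto_atTop_mono (fun n => ((le_max_right _ _).trans_lt (hlt n)).le)
    tendsto_natCast_atTop_atTop

theorem exists_gt_secAq_ker_ne_zero {V E : Type} [Fintype V] [Fintype E] {ι τ : E → V}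
    (hconn : IsConnectedGraph ι τ) (htree : Fintype.card E + 1 = Fintype.card V)
    {ℓ : E → ℝ} (hℓ : ∀ e, 0 < ℓ e) (q : E → ℝ) (a : ℝ) :
    ∃ ω > a, (∀ e, q e < ω ^ 2) ∧ ∃ x : V ⊕ E × Bool → ℝ,
      (secAq ι τ ℓ q ω).mulVec x = 0 ∧ ∀ v, x (Sum.inl v) ≠ 0 := by
  obtain ⟨r⟩ : Nonempty V := Fintype.card_pos_iff.1 (by omega)
  obtain ⟨z, hzc, η, hη, hz⟩ := exists_positive_family hconn htree r
  obtain ⟨δ, hδ, hδη⟩ : ∃ δ > 0, ∀ e, ℓ e * δ < η / 2 := by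
    have : ∀ᶠ δ in 𝓝[>] (0 : ℝ), ∀ e, ℓ e * δ < η / 2 := by
      refine Filter.eventually_all.2 fun e => nhdsWithin_le_nhds ?_
      have : ContinuousAt (fun δ : ℝ => ℓ e * δ) 0 := by fun_prop
      exact this.eventually (gt_mem_nhds (by simpa using hη))
    obtain ⟨δ, h, hδ⟩ := (this.and self_mem_nhdsWithin).exists
    exact ⟨δ, hδ, h⟩
  obtain ⟨ε, hε, hεη, hεδ⟩ : ∃ ε > 0, 2 * ε < η / 2 ∧ ∀ e, 2 * ε < ℓ e * δ := by
    have : ∀ᶠ ε in 𝓝[>] (0 : ℝ), 2 * ε < η / 2 ∧ ∀ e, 2 * ε < ℓ e * δ := by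
      have hc : ContinuousAt (fun ε : ℝ => 2 * ε) 0 := by fun_prop
      refine Filter.Eventually.and (nhdsWithin_le_nhds (hc.eventually (gt_mem_nhds ?_)))
        (Filter.eventually_all.2 fun e => nhdsWithin_le_nhds (hc.eventually (gt_mem_nhds ?_)))
      · simpa using hη
      · simpa using mul_pos (hℓ e) hδ
    obtain ⟨ε, h, hε⟩ := (this.and self_mem_nhdsWithin).exists
    exact ⟨ε, hε, h⟩
  obtain ⟨N, hN⟩ : ∃ N : ℝ, ∀ ω ≥ N, a < ω ∧ ∀ e, q e < ω ^ 2 ∧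
      |ℓ e * √(ω ^ 2 - q e) - ℓ e * ω| < ε := by
    refine Filter.eventually_atTop.1 ((eventually_gt_atTop a).and
      (Filter.eventually_all.2 fun e => Filter.Eventually.and ?_ ?_))
    · exact (tendsto_pow_atTop two_ne_zero).eventually (eventually_gt_atTop (q e))
    · have := (tendsto_sqrt_sq_sub_sub_self (q e)).const_mul (ℓ e)
      rw [mul_zero] at this
      filter_upwards [this.eventually (Metric.ball_mem_nhds 0 hε)] with ω hω
      rwa [dist_zero_right, Real.norm_eq_abs, mul_sub] at hω
  obtain ⟨K, hK⟩ := exists_nat_ge (N + δ)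
  obtain ⟨n, hnK, m, hm⟩ := exists_nat_forall_near_two_pi ℓ hε K
  have hn : N + δ ≤ n := hK.trans (by exact_mod_cast hnK)
  let Θ : ℝ → E → ℝ := fun ω e => ℓ e * √(ω ^ 2 - q e) - m e * (2 * Real.pi)
  have hΘc : Continuous Θ := by fun_prop
  have hA : ∀ ω, secAq ι τ ℓ q ω =
      secMatrix ι τ ∅ (fun e => Real.cos (Θ ω e)) (fun e => Real.sin (Θ ω e)) := by
    intro ω
    simp only [secAq, Θ, Real.cos_sub_int_mul_two_pi, Real.sin_sub_int_mul_two_pi]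
  have hclose : ∀ ω ≥ N, ∀ e, |Θ ω e - ℓ e * (ω - n)| < 2 * ε := by
    intro ω hω e
    have h1 := ((hN ω hω).2 e).2
    have h2 := hm e
    rw [abs_lt] at h1 h2 ⊢
    simp only [Θ]
    constructor <;> linarith [h1.1, h1.2, h2.1, h2.2]
  have hsmall : ∀ ω ∈ Set.Icc (n - δ) (n + δ), ∀ e, |Θ ω e| < η := by
    intro ω hω e
    have h1 := abs_lt.1 (hclose ω (by linarith [hω.1]) e)
    have h2 := hδη e
    have h3 := hℓ e
    rw [abs_lt]
    constructor
    · nlinarith [hω.1]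
    · nlinarith [hω.2]
  let R : ℝ → ℝ := fun ω => (secAq ι τ ℓ q ω).mulVec (z (Θ ω)) (Sum.inl r)
  have hR : Continuous R := by
    have : ∀ i, Continuous fun ω => z (Θ ω) i := fun i =>
      (continuous_apply i).comp (hzc.comp hΘc)
    simp only [R, hA, secMatrix_mulVec_inl]
    refine continuous_finsetSum _ fun e _ => ?_
    split_ifs <;> fun_prop
  have hab : (n : ℝ) - δ ≤ n + δ := by linarith
  have hend : R (n + δ) ≤ 0 := by
    simp only [R, hA]
    refine (hz _ (hsmall _ (Set.right_mem_Icc.2 hab))).2.2.1 fun e => ?_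
    have h := abs_lt.1 (hclose (n + δ) (by linarith) e)
    have := hεδ e
    rw [add_sub_cancel_left] at h
    linarith [h.1]
  have hstart : 0 ≤ R (n - δ) := by
    simp only [R, hA]
    refine (hz _ (hsmall _ (Set.left_mem_Icc.2 hab))).2.2.2 fun e => ?_
    have h := abs_lt.1 (hclose (n - δ) (by linarith) e)
    have := hεδ e
    rw [sub_sub_cancel_left] at h
    linarith [h.2]
  obtain ⟨ω, hω, hRω⟩ := intermediate_value_Icc' hab hR.continuousOn ⟨hend, hstart⟩
  have hωN := hN ω (by linarith [hω.1])
  obtain ⟨hpos, hrows, -, -⟩ := hz _ (hsmall ω hω)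
  refine ⟨ω, hωN.1, fun e => (hωN.2 e).1, z (Θ ω), ?_, fun v => (hpos v).ne'⟩
  ext i
  by_cases hi : i = Sum.inl r
  · rw [hi]; exact hRω
  · rw [hA]; exact hrows i hi

/-- On a compact metric tree, the Schrödinger operator `-ψ'' + q_e ψ` with an edgewise
constant potential and standard conditions admits an infinite strictly increasing sequence
of eigenfrequencies `ω_n → ∞` with `ω_n² > q e`, whose secular-matrix kernel vectors are
nonzero at every vertex. -/
theorem tree_potential_generic {V E : Type} [Fintype V] [Fintype E]
    (ι τ : E → V) (hnl : ∀ e, ι e ≠ τ e)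
    (hconn : IsConnectedGraph ι τ)
    (htree : Fintype.card E + 1 = Fintype.card V)
    (ℓ : E → ℝ) (hℓ : ∀ e, 0 < ℓ e)
    (q : E → ℝ) :
    ∃ ω : ℕ → ℝ, StrictMono ω ∧
      Tendsto ω atTop atTop ∧
      (∀ n : ℕ, ∀ e : E, q e < (ω n) ^ 2) ∧
      ∀ n : ℕ, ∃ x : (V ⊕ E × Bool) → ℝ, x ≠ 0 ∧
        (secAq ι τ ℓ q (ω n)).mulVec x = 0 ∧
        ∀ v : V, x (Sum.inl v) ≠ 0 := by
  obtain ⟨ω, hmono, htend, hω⟩ := exists_strictMono_tendsto_of_forall_exists_gt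
    (exists_gt_secAq_ker_ne_zero hconn htree hℓ q)
  refine ⟨ω, hmono, htend, fun n => (hω n).1, fun n => ?_⟩
  obtain ⟨x, hx, hne⟩ := (hω n).2
  obtain ⟨r⟩ : Nonempty V := Fintype.card_pos_iff.1 (by omega)
  exact ⟨x, fun h => hne r (by rw [h]; rfl), hx, hne⟩
end

section
/- Let G be a graph with edge lengths ℓ and Dirichlet set V_D, let e₀ ∈ E, and let G' be the graph identical to G except that the orientation of e₀ is reversed, i.e. ι'(e₀) = τ(e₀) and τ'(e₀) = ι(e₀), with the same edge lengths and the same Dirichlet set. Then det A_ω(G', V_D) = det A_ω(G, V_D) for every ω ∈ ℝ. -/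
open Matrix Filter Topology

attribute [local instance] Classical.propDecidable

/-- Replacing two distinct rows by linear combinations of them multiplies the determinant
by the determinant of the coefficient matrix. -/
theorem det_updateRow_updateRow_combination {n : Type} [Fintype n] [DecidableEq n]
    (A : Matrix n n ℝ) {i j : n} (hij : i ≠ j) (p q r t : ℝ) :
    ((A.updateRow i (p • A i + q • A j)).updateRow j (r • A i + t • A j)).det
      = (p * t - q * r) * A.det := by
  have hii : ((A.updateRow i (A i)).updateRow j (A i)).det = 0 :=
    det_zero_of_row_eq hij (by simp [updateRow_ne hij])
  have hjj : ((A.updateRow i (A j)).updateRow j (A j)).det = 0 :=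
    det_zero_of_row_eq hij (by simp [updateRow_ne hij])
  have hid : ((A.updateRow i (A i)).updateRow j (A j)).det = A.det := by
    simp [updateRow_eq_self]
  have hswap : ((A.updateRow i (A j)).updateRow j (A i)).det = -A.det := by
    have h : (A.updateRow i (A j)).updateRow j (A i) = A.submatrix (Equiv.swap i j) id := by
      ext k l
      by_cases hkj : k = j
      · subst hkj; simp
      · by_cases hki : k = i
        · subst hki; simp [updateRow_ne hkj]
        · simp [updateRow_ne hkj, updateRow_ne hki, Equiv.swap_apply_of_ne_of_ne hki hkj]
    rw [h, det_permute]
    simp [Equiv.Perm.sign_swap hij]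
  rw [det_updateRow_add, det_updateRow_smul, det_updateRow_smul]
  simp only [updateRow_comm _ hij] at *
  simp only [det_updateRow_add, det_updateRow_smul, hii, hjj, hid, hswap]
  ring

/-- After exchanging the two columns of the reversed edge, the rows of the reversed edge are
linear combinations of the original ones, and all other rows are unchanged. -/
theorem secMatrix_reverse_edge_submatrix {V E : Type} [DecidableEq E]
    (ι τ : E → V) (VD : Set V) (c s : E → ℝ) (e₀ : E) (hcs : c e₀ ^ 2 + s e₀ ^ 2 = 1) :
    (secMatrix (Function.update ι e₀ (τ e₀)) (Function.update τ e₀ (ι e₀)) VD c s).submatrix id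
        (Equiv.swap (Sum.inr (e₀, false)) (Sum.inr (e₀, true)))
      = ((secMatrix ι τ VD c s).updateRow (Sum.inr (e₀, false))
            ((-c e₀) • secMatrix ι τ VD c s (Sum.inr (e₀, false))
              + s e₀ • secMatrix ι τ VD c s (Sum.inr (e₀, true)))).updateRow
          (Sum.inr (e₀, true))
            (s e₀ • secMatrix ι τ VD c s (Sum.inr (e₀, false))
              + c e₀ • secMatrix ι τ VD c s (Sum.inr (e₀, true))) := by
  ext i j
  rcases i with v | ⟨e, b⟩ <;> rcases j with u | ⟨f, b'⟩
  · simp [secMatrix, updateRow_apply, Equiv.swap_apply_def]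
  · by_cases hf : f = e₀
    · subst hf
      cases b' <;> simp [secMatrix, updateRow_apply]
    · simp [secMatrix, updateRow_apply, Equiv.swap_apply_def, hf]
  · by_cases he : e = e₀
    · subst he
      cases b <;> simp [secMatrix, updateRow_apply, Equiv.swap_apply_def] <;> split_ifs <;>
        grind
    · simp [secMatrix, updateRow_apply, Equiv.swap_apply_def, he]
  · by_cases he : e = e₀ <;> by_cases hf : f = e₀
    · subst he hf
      cases b <;> cases b' <;> simp [secMatrix, updateRow_apply] <;> grind
    · subst he
      cases b <;> simp [secMatrix, updateRow_apply, Equiv.swap_apply_def, hf]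
    · subst hf
      cases b <;> cases b' <;>
        simp [secMatrix, updateRow_apply, he, Ne.symm he]
    · simp [secMatrix, updateRow_apply, Equiv.swap_apply_def, he, hf]

/-- Reversing the orientation of a single edge does not change the secular determinant. -/
theorem det_secA_reverse_edge {V E : Type} [Fintype V] [Fintype E] [DecidableEq E]
    (ι τ : E → V) (hnl : ∀ e, ι e ≠ τ e)
    (ℓ : E → ℝ) (hℓ : ∀ e, 0 < ℓ e)
    (VD : Set V) (e₀ : E) (ω : ℝ) :
    (secA (Function.update ι e₀ (τ e₀)) (Function.update τ e₀ (ι e₀)) VD ℓ ω).det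
      = (secA ι τ VD ℓ ω).det := by
  have hcs : Real.cos (ℓ e₀ * ω) ^ 2 + Real.sin (ℓ e₀ * ω) ^ 2 = 1 :=
    Real.cos_sq_add_sin_sq _
  have hne : (Sum.inr (e₀, false) : V ⊕ E × Bool) ≠ Sum.inr (e₀, true) := by simp
  have h := congrArg Matrix.det (secMatrix_reverse_edge_submatrix ι τ VD
    (fun e => Real.cos (ℓ e * ω)) (fun e => Real.sin (ℓ e * ω)) e₀ hcs)
  rw [det_permute', det_updateRow_updateRow_combination _ hne, Equiv.Perm.sign_swap hne] at h
  simp only [secA]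
  push_cast at h
  linear_combination -h + hcs * (secMatrix ι τ VD (fun e => Real.cos (ℓ e * ω))
    (fun e => Real.sin (ℓ e * ω))).det
end

section
/- Let G be a graph with edge lengths ℓ and Dirichlet set V_D, let e₀ ∈ E have ι(e₀) = u, τ(e₀) = w, and let ℓ₁, ℓ₂ > 0 with ℓ₁ + ℓ₂ = ℓ(e₀). Let G' be the graph obtained from G by deleting e₀ and adding one new vertex v (not in V_D, i.e. with standard conditions) together with two new edges e₁ from u to v of length ℓ₁ and e₂ from v to w of length ℓ₂, keeping all other data unchanged. Then det A_ω(G', V_D) = det A_ω(G, V_D) for every ω ∈ ℝ. -/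
open Matrix Filter Topology

attribute [local instance] Classical.propDecidable

/-- If block row operations turn the first block row `[P Q]` into `[A 0]`,
then the determinant factors as `det A * det S`. -/
theorem Matrix.det_fromBlocks_of_rowOp {m n R : Type*} [Fintype m] [Fintype n]
    [DecidableEq m] [DecidableEq n] [CommRing R]
    (P A : Matrix m m R) (Q : Matrix m n R) (C : Matrix n m R) (S : Matrix n n R)
    (X : Matrix m n R) (hA : P + X * C = A) (hQ : Q + X * S = 0) :
    (fromBlocks P Q C S).det = A.det * S.det := by
  have h : fromBlocks 1 X 0 1 * fromBlocks P Q C S = fromBlocks A 0 C S := by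
    simp [fromBlocks_multiply, hA, hQ]
  simpa using congrArg Matrix.det h

section Subdivision

variable {V E : Type} (e₀ : E)

/-- The indices of the subdivided graph's secular matrix, listed as the indices of the original
matrix (with `(e₀, b)` sent to the outer half-edges) followed by the three new ones. -/
noncomputable def subdivisionIndex :
    (V ⊕ E × Bool) ⊕ Fin 3 → (V ⊕ Unit) ⊕ ({e : E // e ≠ e₀} ⊕ Bool) × Bool
  | Sum.inl (Sum.inl v) => Sum.inl (Sum.inl v)
  | Sum.inl (Sum.inr (e, b)) =>
      if h : e = e₀ then Sum.inr (Sum.inr b, b) else Sum.inr (Sum.inl ⟨e, h⟩, b)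
  | Sum.inr k =>
      ![Sum.inl (Sum.inr ()), Sum.inr (Sum.inr false, true), Sum.inr (Sum.inr true, false)] k

theorem subdivisionIndex_bijective :
    Function.Bijective (subdivisionIndex (V := V) e₀) := by
  constructor
  · rintro ((v | ⟨e, b⟩) | k) ((v' | ⟨e', b'⟩) | k') h
    all_goals try fin_cases k
    all_goals try fin_cases k'
    all_goals try by_cases he : e = e₀
    all_goals try by_cases he' : e' = e₀
    all_goals simp_all [subdivisionIndex]
  · rintro ((v | u) | ⟨e | (_ | _), (_ | _)⟩)
    · exact ⟨Sum.inl (Sum.inl v), rfl⟩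
    · exact ⟨Sum.inr 0, rfl⟩
    · exact ⟨Sum.inl (Sum.inr (e, false)), by simp [subdivisionIndex, e.2]⟩
    · exact ⟨Sum.inl (Sum.inr (e, true)), by simp [subdivisionIndex, e.2]⟩
    · exact ⟨Sum.inl (Sum.inr (e₀, false)), by simp [subdivisionIndex]⟩
    · exact ⟨Sum.inr 1, rfl⟩
    · exact ⟨Sum.inr 2, rfl⟩
    · exact ⟨Sum.inl (Sum.inr (e₀, true)), by simp [subdivisionIndex]⟩

/-- `subdivisionIndex` as an equivalence. -/
noncomputable def subdivisionEquiv :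
    (V ⊕ E × Bool) ⊕ Fin 3 ≃ (V ⊕ Unit) ⊕ ({e : E // e ≠ e₀} ⊕ Bool) × Bool :=
  Equiv.ofBijective _ (subdivisionIndex_bijective e₀)

/-- The transposition of the indices `(e₁, 0)` and `(e₂, 0)` of the two new edges. -/
noncomputable def subdivisionSwap :
    Equiv.Perm ((V ⊕ Unit) ⊕ ({e : E // e ≠ e₀} ⊕ Bool) × Bool) :=
  Equiv.swap (Sum.inr (Sum.inr false, false)) (Sum.inr (Sum.inr true, false))

@[simp] theorem subdivisionEquiv_vertex (v : V) :
    subdivisionEquiv e₀ (Sum.inl (Sum.inl v)) = Sum.inl (Sum.inl v) := rfl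

@[simp] theorem subdivisionEquiv_self (b : Bool) :
    subdivisionEquiv (V := V) e₀ (Sum.inl (Sum.inr (e₀, b))) = Sum.inr (Sum.inr b, b) := by
  simp [subdivisionEquiv, subdivisionIndex]

theorem subdivisionEquiv_of_ne {e : E} (h : e ≠ e₀) (b : Bool) :
    subdivisionEquiv (V := V) e₀ (Sum.inl (Sum.inr (e, b))) = Sum.inr (Sum.inl ⟨e, h⟩, b) := by
  simp [subdivisionEquiv, subdivisionIndex, h]

@[simp] theorem subdivisionEquiv_zero :
    subdivisionEquiv (V := V) e₀ (Sum.inr 0) = Sum.inl (Sum.inr ()) := rfl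

@[simp] theorem subdivisionEquiv_one :
    subdivisionEquiv (V := V) e₀ (Sum.inr 1) = Sum.inr (Sum.inr false, true) := rfl

@[simp] theorem subdivisionEquiv_two :
    subdivisionEquiv (V := V) e₀ (Sum.inr 2) = Sum.inr (Sum.inr true, false) := rfl

@[simp] theorem subdivisionSwap_vertex (v : V ⊕ Unit) :
    subdivisionSwap e₀ (Sum.inl v) = Sum.inl v := by
  simp [subdivisionSwap, Equiv.swap_apply_def]

@[simp] theorem subdivisionSwap_edge (e : {e : E // e ≠ e₀}) (b : Bool) :
    subdivisionSwap (V := V) e₀ (Sum.inr (Sum.inl e, b)) = Sum.inr (Sum.inl e, b) := by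
  simp [subdivisionSwap, Equiv.swap_apply_def]

@[simp] theorem subdivisionSwap_half_true (b : Bool) :
    subdivisionSwap (V := V) e₀ (Sum.inr (Sum.inr b, true)) = Sum.inr (Sum.inr b, true) := by
  simp [subdivisionSwap, Equiv.swap_apply_def]

@[simp] theorem subdivisionSwap_half_false (b : Bool) :
    subdivisionSwap (V := V) e₀ (Sum.inr (Sum.inr b, false)) = Sum.inr (Sum.inr !b, false) := by
  cases b <;> simp [subdivisionSwap]

/-- Coefficients of the row operations that merge the equations of the two halves of `e₀`;
the three columns refer to the rows of the new vertex, `(e₁, 1)` and `(e₁, 0)`. -/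
noncomputable def subdivisionRowOp (c s : ℝ) : Matrix (V ⊕ E × Bool) (Fin 3) ℝ :=
  Matrix.of fun i =>
    match i with
    | Sum.inl _ => 0
    | Sum.inr (e, b) => if e = e₀ then (if b then ![-c, c, -s] else ![-s, s, c]) else 0

end Subdivision

/-- Subdividing an edge `e₀` of length `ℓ e₀ = ℓ₁ + ℓ₂` into two edges of lengths
`ℓ₁`, `ℓ₂` by a new vertex with standard conditions does not change the secular
determinant.  In the subdivided graph the vertex set is `V ⊕ Unit` (the new vertex is
`Sum.inr ()`), the edge set is `{e // e ≠ e₀} ⊕ Bool`, where `Sum.inr false` is the edge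
from `ι e₀` to the new vertex (of length `ℓ₁`) and `Sum.inr true` the edge from the new
vertex to `τ e₀` (of length `ℓ₂`). -/
theorem det_secA_subdivide_edge {V E : Type} [Fintype V] [Fintype E]
    (ι τ : E → V) (hnl : ∀ e, ι e ≠ τ e)
    (ℓ : E → ℝ) (hℓ : ∀ e, 0 < ℓ e)
    (VD : Set V) (e₀ : E) (ℓ₁ ℓ₂ : ℝ) (h₁ : 0 < ℓ₁) (h₂ : 0 < ℓ₂)
    (hsum : ℓ₁ + ℓ₂ = ℓ e₀) (ω : ℝ) :
    (secA
      (Sum.elim (fun e' : {e : E // e ≠ e₀} => (Sum.inl (ι e'.1) : V ⊕ Unit))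
        (fun b : Bool => if b then Sum.inr () else Sum.inl (ι e₀)))
      (Sum.elim (fun e' : {e : E // e ≠ e₀} => (Sum.inl (τ e'.1) : V ⊕ Unit))
        (fun b : Bool => if b then Sum.inl (τ e₀) else Sum.inr ()))
      (Sum.inl '' VD)
      (Sum.elim (fun e' : {e : E // e ≠ e₀} => ℓ e'.1)
        (fun b : Bool => if b then ℓ₂ else ℓ₁)) ω).det
      = (secA ι τ VD ℓ ω).det := by
  set A' := secA
      (Sum.elim (fun e' : {e : E // e ≠ e₀} => (Sum.inl (ι e'.1) : V ⊕ Unit))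
        (fun b : Bool => if b then Sum.inr () else Sum.inl (ι e₀)))
      (Sum.elim (fun e' : {e : E // e ≠ e₀} => (Sum.inl (τ e'.1) : V ⊕ Unit))
        (fun b : Bool => if b then Sum.inl (τ e₀) else Sum.inr ()))
      (Sum.inl '' VD)
      (Sum.elim (fun e' : {e : E // e ≠ e₀} => ℓ e'.1)
        (fun b : Bool => if b then ℓ₂ else ℓ₁)) ω with hA'
  have hcos : Real.cos (ℓ e₀ * ω) =
      Real.cos (ℓ₁ * ω) * Real.cos (ℓ₂ * ω) - Real.sin (ℓ₁ * ω) * Real.sin (ℓ₂ * ω) := by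
    rw [← hsum, add_mul, Real.cos_add]
  have hsin : Real.sin (ℓ e₀ * ω) =
      Real.sin (ℓ₁ * ω) * Real.cos (ℓ₂ * ω) + Real.cos (ℓ₁ * ω) * Real.sin (ℓ₂ * ω) := by
    rw [← hsum, add_mul, Real.sin_add]
  set B := (A'.submatrix (subdivisionSwap e₀) id).submatrix (subdivisionEquiv e₀)
    (subdivisionEquiv e₀) with hB
  have hdet : B.det = -A'.det := by
    rw [hB, Matrix.det_submatrix_equiv_self, Matrix.det_permute, subdivisionSwap,
      Equiv.Perm.sign_swap (by simp)]
    simp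
  have hS : B.toBlocks₂₂.det = -1 := by
    simp [Matrix.det_fin_three, Matrix.toBlocks₂₂, hB, hA', secA, secMatrix]
  have hblocks : B.det = (secA ι τ VD ℓ ω).det * B.toBlocks₂₂.det := by
    rw [← Matrix.fromBlocks_toBlocks B]
    refine Matrix.det_fromBlocks_of_rowOp _ _ _ _ _
      (subdivisionRowOp e₀ (Real.cos (ℓ₂ * ω)) (Real.sin (ℓ₂ * ω))) ?_ ?_
    · ext (v | ⟨e, b⟩) (v' | ⟨f, b'⟩)
      · simp [Matrix.mul_apply, Matrix.toBlocks₁₁, Matrix.toBlocks₂₁,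
          subdivisionRowOp, hB, hA', secA, secMatrix]
      · by_cases hf : f = e₀
        · subst hf
          cases b' <;> simp [Matrix.mul_apply, Matrix.toBlocks₁₁,
            Matrix.toBlocks₂₁, subdivisionRowOp, hB, hA', secA, secMatrix]
        · cases b' <;> simp [Matrix.mul_apply, Matrix.toBlocks₁₁,
            Matrix.toBlocks₂₁, subdivisionRowOp, hB, hA', secA, secMatrix,
            subdivisionEquiv_of_ne e₀ hf]
      · by_cases he : e = e₀
        · subst he
          cases b <;> simp [Matrix.mul_apply, Fin.sum_univ_three, Matrix.toBlocks₁₁,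
            Matrix.toBlocks₂₁, subdivisionRowOp, hB, hA', secA, secMatrix, hcos, hsin]
          all_goals split_ifs <;> ring
        · cases b <;> simp [Matrix.mul_apply, Matrix.toBlocks₁₁,
            Matrix.toBlocks₂₁, subdivisionRowOp, hB, hA', secA, secMatrix,
            subdivisionEquiv_of_ne e₀ he, he]
      · by_cases he : e = e₀
        · subst he
          by_cases hf : f = e
          · subst hf
            cases b <;> cases b' <;> simp [Matrix.mul_apply, Fin.sum_univ_three,
              Matrix.toBlocks₁₁, Matrix.toBlocks₂₁, subdivisionRowOp, hB, hA', secA, secMatrix,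
              hcos, hsin]
            all_goals ring
          · cases b <;> cases b' <;> simp [Matrix.mul_apply, Fin.sum_univ_three,
              Matrix.toBlocks₁₁, Matrix.toBlocks₂₁, subdivisionRowOp, hB, hA', secA, secMatrix,
              subdivisionEquiv_of_ne e hf, hf]
        · by_cases hf : f = e₀
          · subst hf
            cases b <;> cases b' <;> simp [Matrix.mul_apply,
              Matrix.toBlocks₁₁, Matrix.toBlocks₂₁, subdivisionRowOp, hB, hA', secA, secMatrix,
              subdivisionEquiv_of_ne f he, he, Ne.symm he]
          · cases b <;> cases b' <;> simp [Matrix.mul_apply,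
              Matrix.toBlocks₁₁, Matrix.toBlocks₂₁, subdivisionRowOp, hB, hA', secA, secMatrix,
              subdivisionEquiv_of_ne e₀ he, subdivisionEquiv_of_ne e₀ hf, he]
    · ext (v | ⟨e, b⟩) k
      · fin_cases k <;> simp [Matrix.mul_apply, Matrix.toBlocks₁₂,
          Matrix.toBlocks₂₂, subdivisionRowOp, hB, hA', secA, secMatrix]
      · by_cases he : e = e₀
        · subst he
          cases b <;> fin_cases k <;> simp [Matrix.mul_apply, Fin.sum_univ_three,
            Matrix.toBlocks₁₂, Matrix.toBlocks₂₂, subdivisionRowOp, hB, hA', secA, secMatrix]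
        · cases b <;> fin_cases k <;> simp [Matrix.mul_apply,
            Matrix.toBlocks₁₂, Matrix.toBlocks₂₂, subdivisionRowOp, hB, hA', secA, secMatrix,
            subdivisionEquiv_of_ne e₀ he, he]
  linarith [hblocks.symm.trans hdet, hS ▸ hblocks]
end

section
/- Let G be a tree with edge lengths ℓ and V_D = ∅ (standard conditions at all vertices). Then the kernel of the matrix A_0(G) is one-dimensional and equals the span of the vector x₀ defined by x₀(v) = 1 for every v ∈ V and x₀((e,0)) = x₀((e,1)) = 0 for every e ∈ E. -/
open Matrix Filter Topology

attribute [local instance] Classical.propDecidable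

/-- The difference operator sending a function on vertices to its increments along edges. -/
def edgeDiff {V E : Type} (ι τ : E → V) : (V → ℝ) →ₗ[ℝ] (E → ℝ) where
  toFun f e := f (ι e) - f (τ e)
  map_add' f g := by ext e; simp only [Pi.add_apply]; ring
  map_smul' a f := by ext e; simp only [Pi.smul_apply, smul_eq_mul, RingHom.id_apply]; ring

theorem ker_edgeDiff {V E : Type} [Nonempty V] {ι τ : E → V} (hconn : IsConnectedGraph ι τ) :
    LinearMap.ker (edgeDiff ι τ) = Submodule.span ℝ {fun _ : V => (1 : ℝ)} := by
  ext f
  rw [LinearMap.mem_ker, Submodule.mem_span_singleton]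
  constructor
  · intro h
    have hf : ∀ e, f (ι e) = f (τ e) := fun e => sub_eq_zero.mp (congrFun h e)
    refine ⟨f (Classical.arbitrary V), ?_⟩
    ext v
    simpa using hconn.eq_of_edge_eq hf _ v
  · rintro ⟨a, rfl⟩
    ext e
    simp [edgeDiff]

theorem edgeDiff_surjective {V E : Type} [Fintype V] [Fintype E] {ι τ : E → V}
    (hconn : IsConnectedGraph ι τ) (htree : Fintype.card E + 1 = Fintype.card V) :
    Function.Surjective (edgeDiff ι τ) := by
  have : Nonempty V := Fintype.card_pos_iff.mp (by omega)
  rw [← LinearMap.range_eq_top]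
  apply Submodule.eq_top_of_finrank_eq
  have h := (edgeDiff ι τ).finrank_range_add_finrank_ker
  rw [ker_edgeDiff hconn, finrank_span_singleton (fun h => one_ne_zero (congrFun h
    (Classical.arbitrary V))), Module.finrank_fintype_fun_eq_card] at h
  rw [Module.finrank_fintype_fun_eq_card]
  omega

/-- A flow on a tree satisfying Kirchhoff's law at every vertex vanishes. -/
theorem eq_zero_of_kirchhoff {V E : Type} [Fintype V] [Fintype E] {ι τ : E → V}
    (hconn : IsConnectedGraph ι τ) (htree : Fintype.card E + 1 = Fintype.card V) {y : E → ℝ}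
    (hy : ∀ v, ∑ e, ((if ι e = v then y e else 0) - (if τ e = v then y e else 0)) = 0) :
    y = 0 := by
  obtain ⟨f, hf⟩ := edgeDiff_surjective hconn htree y
  have key : ∑ e, y e * y e = 0 := by
    calc ∑ e, y e * y e = ∑ e, (f (ι e) - f (τ e)) * y e :=
          Finset.sum_congr rfl fun e _ => congrArg (· * y e) (congrFun hf e).symm
      _ = ∑ e, ∑ v, f v * ((if ι e = v then y e else 0) - (if τ e = v then y e else 0)) := by
          refine Finset.sum_congr rfl fun e _ => ?_
          simp [mul_sub, sub_mul, Finset.sum_sub_distrib]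
      _ = ∑ v, f v * ∑ e, ((if ι e = v then y e else 0) - (if τ e = v then y e else 0)) := by
          rw [Finset.sum_comm]
          simp_rw [Finset.mul_sum]
      _ = 0 := by simp [hy]
  ext e
  exact mul_self_eq_zero.mp
    ((Finset.sum_eq_zero_iff_of_nonneg fun e _ => mul_self_nonneg (y e)).mp key e
      (Finset.mem_univ e))

theorem mem_ker_secA_zero_iff {V E : Type} [Fintype V] [Fintype E] (ι τ : E → V) (ℓ : E → ℝ)
    (x : V ⊕ E × Bool → ℝ) :
    x ∈ LinearMap.ker (Matrix.toLin' (secA ι τ (∅ : Set V) ℓ 0)) ↔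
      (∀ v, ∑ e, ((if τ e = v then x (Sum.inr (e, true)) else 0) +
        (if ι e = v then x (Sum.inr (e, false)) else 0)) = 0) ∧
      (∀ e, x (Sum.inl (τ e)) - x (Sum.inl (ι e)) = 0) ∧
      (∀ e, x (Sum.inr (e, false)) + x (Sum.inr (e, true)) = 0) := by
  rw [LinearMap.mem_ker, Matrix.toLin'_apply, funext_iff, Sum.forall, Prod.forall]
  simp [secA, secMatrix, Matrix.mulVec, dotProduct, Fintype.sum_prod_type, add_mul,
    Finset.sum_add_distrib, forall_and, sub_eq_add_neg, and_comm]

/-- On a metric tree with standard conditions at all vertices, the kernel of `A₀(G)` is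
one-dimensional and spanned by the vector that is `1` in every vertex coordinate and `0`
in every edge coordinate. -/
theorem ker_secA_zero_tree {V E : Type} [Fintype V] [Fintype E]
    (ι τ : E → V) (hnl : ∀ e, ι e ≠ τ e)
    (hconn : IsConnectedGraph ι τ)
    (htree : Fintype.card E + 1 = Fintype.card V)
    (ℓ : E → ℝ) (hℓ : ∀ e, 0 < ℓ e) :
    Module.finrank ℝ (LinearMap.ker (Matrix.toLin' (secA ι τ (∅ : Set V) ℓ 0))) = 1 ∧
    LinearMap.ker (Matrix.toLin' (secA ι τ (∅ : Set V) ℓ 0)) =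
      Submodule.span ℝ
        {(Sum.elim (fun _ : V => (1 : ℝ)) (fun _ : E × Bool => (0 : ℝ)))} := by
  have : Nonempty V := Fintype.card_pos_iff.mp (by omega)
  have hker : LinearMap.ker (Matrix.toLin' (secA ι τ (∅ : Set V) ℓ 0)) =
      Submodule.span ℝ
        {(Sum.elim (fun _ : V => (1 : ℝ)) (fun _ : E × Bool => (0 : ℝ)))} := by
    ext x
    rw [mem_ker_secA_zero_iff, Submodule.mem_span_singleton]
    constructor
    · rintro ⟨hv, h0, h1⟩
      have ht : ∀ e, x (Sum.inr (e, true)) = -x (Sum.inr (e, false)) := fun e =>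
        eq_neg_of_add_eq_zero_right (h1 e)
      have hy : (fun e => x (Sum.inr (e, false))) = 0 := by
        refine eq_zero_of_kirchhoff hconn htree fun v => ?_
        refine (Finset.sum_congr rfl fun e _ => ?_).trans (hv v)
        rw [ht e]
        split_ifs <;> ring
      have hf : ∀ e, x (Sum.inr (e, false)) = 0 := congrFun hy
      refine ⟨x (Sum.inl (Classical.arbitrary V)), ?_⟩
      ext (v | ⟨e, _ | _⟩)
      · simpa using hconn.eq_of_edge_eq (f := fun v => x (Sum.inl v))
          (fun e => (sub_eq_zero.mp (h0 e)).symm) _ v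
      · simp [hf]
      · simp [ht, hf]
    · rintro ⟨a, rfl⟩
      simp
  refine ⟨?_, hker⟩
  rw [hker]
  exact finrank_span_singleton fun h =>
    one_ne_zero (congrFun h (Sum.inl (Classical.arbitrary V)))
end

section
/- Let G be a connected graph with edge lengths ℓ and let V_D ⊆ V be nonempty, with every vertex in V_D of degree one. Then the dimension of the kernel of A_0(G, V_D) equals |V_D| + β(G) − 1, where β(G) = |E| − |V| + 1 is the first Betti number of G. -/
open Matrix Filter Topology

attribute [local instance] Classical.propDecidable

/-- The oriented incidence matrix of a graph, with rows restricted to the non-Dirichlet vertices. -/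
noncomputable def reducedIncMatrix {V E : Type} (ι τ : E → V) (VD : Set V) :
    Matrix {v : V // v ∉ VD} E ℝ :=
  Matrix.of fun v e => (if ι e = v then (1 : ℝ) else 0) - (if τ e = v then 1 else 0)

theorem eq_of_isConnectedGraph {V E α : Type} {ι τ : E → V} (hconn : IsConnectedGraph ι τ)
    {g : V → α} (hg : ∀ e, g (ι e) = g (τ e)) (u w : V) : g u = g w := by
  induction hconn u w with
  | refl => rfl
  | tail _ h ih =>
    obtain ⟨e, ⟨rfl, rfl⟩ | ⟨rfl, rfl⟩⟩ := h
    · exact ih.trans (hg e)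
    · exact ih.trans (hg e).symm

theorem reducedIncMatrix_rank {V E : Type} [Fintype V] [Fintype E] {ι τ : E → V}
    (hconn : IsConnectedGraph ι τ) {VD : Set V} (hVD : VD.Nonempty) :
    (reducedIncMatrix ι τ VD).rank = Fintype.card {v : V // v ∉ VD} := by
  have hinj : Function.Injective (reducedIncMatrix ι τ VD)ᵀ.mulVecLin := by
    rw [← LinearMap.ker_eq_bot, LinearMap.ker_eq_bot']
    intro g hg
    let g' : V → ℝ := fun v => if h : v ∈ VD then 0 else g ⟨v, h⟩
    have key (u : V) : ∑ v : {v : V // v ∉ VD}, (if u = v then (1 : ℝ) else 0) * g v = g' u := by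
      by_cases hu : u ∈ VD
      · simp only [g', hu, dif_pos]
        refine Finset.sum_eq_zero fun v _ => ?_
        have : u ≠ v := fun h => v.2 (h ▸ hu)
        simp [this]
      · rw [Finset.sum_eq_single ⟨u, hu⟩]
        · simp [g', hu]
        · intro v _ hv
          have : u ≠ v := fun h => hv (Subtype.ext h.symm)
          simp [this]
        · simp
    have hg' (e : E) : g' (ι e) = g' (τ e) := by
      have := congrFun hg e
      simp only [Matrix.mulVecLin_apply, Matrix.mulVec, dotProduct, Matrix.transpose_apply,
        reducedIncMatrix, Matrix.of_apply, sub_mul, Finset.sum_sub_distrib, key,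
        Pi.zero_apply] at this
      exact sub_eq_zero.mp this
    obtain ⟨d, hd⟩ := hVD
    ext v
    have h := eq_of_isConnectedGraph hconn hg' v d
    simpa [g', hd, v.2] using h
  rw [← Matrix.rank_transpose, Matrix.rank, LinearMap.finrank_range_of_inj hinj,
    Module.finrank_fintype_fun_eq_card]

/-- The vector of edge data, vanishing at all vertices, given by a flow on the edges. -/
def flowVector (V E : Type) : (E → ℝ) →ₗ[ℝ] (V ⊕ E × Bool → ℝ) where
  toFun y := Sum.elim 0 fun p => if p.2 then -y p.1 else y p.1
  map_add' y z := by
    ext (v | ⟨e, b⟩)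
    · simp
    · cases b <;> simp [add_comm]
  map_smul' r y := by
    ext (v | ⟨e, b⟩)
    · simp
    · cases b <;> simp

theorem flowVector_injective (V E : Type) : Function.Injective (flowVector V E) := by
  intro y z h
  ext e
  simpa [flowVector] using congrFun h (Sum.inr (e, false))

theorem secA_zero_mulVec_edge_initial {V E : Type} [Fintype V] [Fintype E] (ι τ : E → V)
    (VD : Set V) (ℓ : E → ℝ) (x : V ⊕ E × Bool → ℝ) (e : E) :
    (secA ι τ VD ℓ 0 *ᵥ x) (Sum.inr (e, false)) = x (Sum.inl (τ e)) - x (Sum.inl (ι e)) := by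
  simp [secA, secMatrix, Matrix.mulVec, dotProduct, add_mul, Finset.sum_add_distrib,
    sub_eq_add_neg]

theorem secA_zero_mulVec_edge_terminal {V E : Type} [Fintype V] [Fintype E] (ι τ : E → V)
    (VD : Set V) (ℓ : E → ℝ) (x : V ⊕ E × Bool → ℝ) (e : E) :
    (secA ι τ VD ℓ 0 *ᵥ x) (Sum.inr (e, true)) =
      x (Sum.inr (e, false)) + x (Sum.inr (e, true)) := by
  simp [secA, secMatrix, Matrix.mulVec, dotProduct, add_mul, Finset.sum_add_distrib,
    Fintype.sum_prod_type, add_comm]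

theorem secA_mulVec_dirichlet {V E : Type} [Fintype V] [Fintype E] (ι τ : E → V)
    {VD : Set V} (ℓ : E → ℝ) (ω : ℝ) (x : V ⊕ E × Bool → ℝ) {v : V} (hv : v ∈ VD) :
    (secA ι τ VD ℓ ω *ᵥ x) (Sum.inl v) = x (Sum.inl v) := by
  simp [secA, secMatrix, Matrix.mulVec, dotProduct, hv]

theorem secA_mulVec_vertex {V E : Type} [Fintype V] [Fintype E] (ι τ : E → V)
    {VD : Set V} (ℓ : E → ℝ) (ω : ℝ) (x : V ⊕ E × Bool → ℝ) {v : V} (hv : v ∉ VD) :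
    (secA ι τ VD ℓ ω *ᵥ x) (Sum.inl v) =
      ∑ e, ((if ι e = v then x (Sum.inr (e, false)) else 0) +
        if τ e = v then x (Sum.inr (e, true)) else 0) := by
  simp [secA, secMatrix, Matrix.mulVec, dotProduct, hv, Fintype.sum_prod_type, add_comm]

theorem secA_mulVec_flowVector_vertex {V E : Type} [Fintype V] [Fintype E] (ι τ : E → V)
    {VD : Set V} (ℓ : E → ℝ) (ω : ℝ) (y : E → ℝ) (v : {v : V // v ∉ VD}) :
    (secA ι τ VD ℓ ω *ᵥ flowVector V E y) (Sum.inl v) = (reducedIncMatrix ι τ VD *ᵥ y) v := by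
  rw [secA_mulVec_vertex ι τ ℓ ω _ v.2]
  simp only [Matrix.mulVec, dotProduct, reducedIncMatrix, Matrix.of_apply]
  refine Finset.sum_congr rfl fun e _ => ?_
  split_ifs <;> simp [flowVector]

theorem ker_secA_zero_eq_map {V E : Type} [Fintype V] [Fintype E] {ι τ : E → V}
    (hconn : IsConnectedGraph ι τ) (ℓ : E → ℝ) {VD : Set V} (hVD : VD.Nonempty) :
    LinearMap.ker (Matrix.toLin' (secA ι τ VD ℓ 0)) =
      (LinearMap.ker (reducedIncMatrix ι τ VD).mulVecLin).map (flowVector V E) := by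
  ext x
  simp only [LinearMap.mem_ker, Submodule.mem_map, Matrix.toLin'_apply, Matrix.mulVecLin_apply]
  constructor
  · intro hx
    have hvert (v : V) : x (Sum.inl v) = 0 := by
      obtain ⟨d, hd⟩ := hVD
      have hedge (e : E) : x (Sum.inl (ι e)) = x (Sum.inl (τ e)) := by
        have := congrFun hx (Sum.inr (e, false))
        rw [secA_zero_mulVec_edge_initial] at this
        exact (sub_eq_zero.mp this).symm
      have h := congrFun hx (Sum.inl d)
      rw [secA_mulVec_dirichlet ι τ ℓ 0 x hd] at h
      exact (eq_of_isConnectedGraph (g := fun v => x (Sum.inl v)) hconn hedge v d).trans h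
    have hflow : flowVector V E (fun e => x (Sum.inr (e, false))) = x := by
      ext (v | ⟨e, b⟩)
      · simp [flowVector, hvert]
      · have := congrFun hx (Sum.inr (e, true))
        rw [secA_zero_mulVec_edge_terminal, Pi.zero_apply] at this
        cases b
        · simp [flowVector]
        · simp only [flowVector, LinearMap.coe_mk, AddHom.coe_mk, Sum.elim_inr, if_true]
          linarith
    refine ⟨_, ?_, hflow⟩
    ext v
    rw [← secA_mulVec_flowVector_vertex ι τ ℓ 0, hflow, hx]
    rfl
  · rintro ⟨y, hy, rfl⟩
    ext (v | ⟨e, b⟩)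
    · by_cases hv : v ∈ VD
      · rw [secA_mulVec_dirichlet ι τ ℓ 0 _ hv]
        simp [flowVector]
      · rw [secA_mulVec_flowVector_vertex ι τ ℓ 0 y ⟨v, hv⟩, hy]
        rfl
    · cases b
      · rw [secA_zero_mulVec_edge_initial]
        simp [flowVector]
      · rw [secA_zero_mulVec_edge_terminal]
        simp [flowVector]

/-- On a connected graph with a nonempty Dirichlet vertex set `VD` (all of degree one),
the kernel of `A₀(G, V_D)` has dimension `|V_D| + β(G) - 1`, where
`β(G) = |E| - |V| + 1` is the first Betti number. -/
theorem dim_ker_secA_zero_dirichlet {V E : Type} [Fintype V] [Fintype E]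
    (ι τ : E → V) (hnl : ∀ e, ι e ≠ τ e)
    (hconn : IsConnectedGraph ι τ)
    (ℓ : E → ℝ) (hℓ : ∀ e, 0 < ℓ e)
    (VD : Set V) (hVD : VD.Nonempty)
    (hdeg : ∀ v ∈ VD, graphDegree ι τ v = 1) :
    (Module.finrank ℝ (LinearMap.ker (Matrix.toLin' (secA ι τ VD ℓ 0))) : ℤ)
      = (VD.ncard : ℤ) + ((Fintype.card E : ℤ) - (Fintype.card V : ℤ) + 1) - 1 := by
  rw [ker_secA_zero_eq_map hconn ℓ hVD,
    ← (Submodule.equivMapOfInjective _ (flowVector_injective V E) _).finrank_eq]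
  have hrn := LinearMap.finrank_range_add_finrank_ker (reducedIncMatrix ι τ VD).mulVecLin
  have hrank := reducedIncMatrix_rank hconn hVD
  rw [Matrix.rank] at hrank
  rw [hrank, Module.finrank_fintype_fun_eq_card] at hrn
  have hcompl : VD.ncard + Fintype.card {v : V // v ∉ VD} = Fintype.card V := by
    rw [← Nat.card_eq_fintype_card (α := V), ← Set.ncard_add_ncard_compl VD,
      ← Nat.card_coe_set_eq VDᶜ, ← Nat.card_eq_fintype_card]
    rfl
  omega
end

section
/- Let G be a tree with edge lengths ℓ and V_D = ∅. Then the function ω ↦ det A_ω(G) is differentiable and its derivative at ω = 0 equals −∑_{e ∈ E} ℓ(e). In particular, ω ↦ det A_ω(G) has a zero of order exactly one at ω = 0. -/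
open Matrix Filter Topology

attribute [local instance] Classical.propDecidable

/-- Jacobi's formula for the derivative of a determinant. -/
theorem hasDerivAt_det {n : Type} [Fintype n] [DecidableEq n] {A : ℝ → Matrix n n ℝ}
    {A' : Matrix n n ℝ} {x : ℝ}
    (h : ∀ i j, HasDerivAt (fun ω => A ω i j) (A' i j) x) :
    HasDerivAt (fun ω => (A ω).det) ((A x).adjugate * A').trace x := by
  have key : HasDerivAt (fun ω => (A ω).det) (∑ σ : Equiv.Perm n,
      (Equiv.Perm.sign σ : ℝ) * ∑ j, (∏ i ∈ Finset.univ.erase j, A x (σ i) i) • A' (σ j) j) x := by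
    simp only [det_apply']
    exact HasDerivAt.fun_sum fun σ _ =>
      (HasDerivAt.fun_finsetProd fun j _ => h (σ j) j).const_mul _
  convert key using 1
  simp only [Finset.mul_sum]
  rw [Finset.sum_comm]
  refine Finset.sum_congr rfl fun j _ => ?_
  have hcol : ((A x).adjugate * A') j j = ((A x).updateCol j fun i => A' i j).det := by
    rw [← cramer_apply, cramer_eq_adjugate_mulVec]
    rfl
  rw [diag_apply, hcol, det_apply']
  refine Finset.sum_congr rfl fun σ _ => ?_
  rw [← Finset.mul_prod_erase _ _ (Finset.mem_univ j), updateCol_self, smul_eq_mul, mul_comm (A' _ _)]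
  congr 2
  exact Finset.prod_congr rfl fun i hi => updateCol_ne (Finset.ne_of_mem_erase hi)

/-- The integer incidence matrix of a graph, augmented by the indicator column of a root `r`. -/
noncomputable def rootedIncidence {V E : Type} (ι τ : E → V) (r : V) : Matrix V (Option E) ℤ :=
  Matrix.of fun v o => o.elim (if v = r then 1 else 0)
    fun e => (if v = τ e then 1 else 0) - (if v = ι e then 1 else 0)

theorem rootedIncidence_mulVec_surjective {V E : Type} [Fintype V] [Fintype E] (ι τ : E → V)
    (hconn : IsConnectedGraph ι τ) (r : V) :
    Function.Surjective (rootedIncidence ι τ r).mulVec := by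
  set M := LinearMap.range (rootedIncidence ι τ r).mulVecLin
  have hcol : ∀ o, (rootedIncidence ι τ r).col o ∈ M := fun o =>
    ⟨Pi.single o 1, by rw [mulVecLin_apply, mulVec_single_one]⟩
  have hedge : ∀ e, (Pi.single (τ e) 1 - Pi.single (ι e) 1 : V → ℤ) ∈ M := fun e => by
    convert hcol (some e) using 1
    ext v
    simp [rootedIncidence, Matrix.col, Pi.single_apply]
  have hv : ∀ v, (Pi.single v 1 : V → ℤ) ∈ M := fun v => by
    induction hconn r v with
    | refl =>
      convert hcol none using 1
      ext v
      simp [rootedIncidence, Matrix.col, Pi.single_apply]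
    | tail _ h ih =>
      obtain ⟨e, ⟨rfl, rfl⟩ | ⟨rfl, rfl⟩⟩ := h
      · simpa using M.add_mem (hedge e) ih
      · simpa using M.sub_mem ih (hedge e)
  intro f
  have hf : f ∈ M := by
    rw [pi_eq_sum_univ' f]
    refine M.sum_mem fun v _ => M.smul_mem _ ?_
    convert hv v using 1
  exact hf

/-- The reduced secular matrix of a tree at frequency zero, grounded at the root `r`, has
determinant one. -/
theorem det_grounded_incidence {V E : Type} [Fintype V] [Fintype E] (ι τ : E → V)
    (hconn : IsConnectedGraph ι τ) (htree : Fintype.card E + 1 = Fintype.card V) (r : V)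
    (D : Matrix V E ℝ)
    (hD : ∀ v e, D v e = (if v = τ e then 1 else 0) - (if v = ι e then 1 else 0)) :
    (fromBlocks (Matrix.single r r 1) (-D) Dᵀ 0).det = 1 := by
  obtain ⟨σ⟩ : Nonempty (V ≃ Option E) :=
    Fintype.card_eq.mp (by rw [Fintype.card_option, htree])
  set Z : Matrix V V ℤ := (rootedIncidence ι τ r).submatrix id σ with hZ
  have hZdet : IsUnit Z.det := by
    obtain ⟨B, hB⟩ := mulVec_surjective_iff_exists_right_inverse.mp
      (rootedIncidence_mulVec_surjective ι τ hconn r)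
    refine isUnit_det_of_right_inverse (B := B.submatrix σ id) ?_
    rw [hZ, submatrix_mul_equiv, hB, submatrix_id_id]
  set W : Matrix V V ℝ := Z.map (Int.castRingHom ℝ) with hW
  have hWdet : W.det * W.det = 1 := by
    have : W.det = (Z.det : ℝ) := ((Int.castRingHom ℝ).map_det Z).symm
    rw [this]
    rcases Int.isUnit_iff.mp hZdet with h | h <;> simp [h]
  set J : Matrix V E ℝ := Matrix.of fun v e => if v = σ.symm (some e) then 1 else 0 with hJ
  have hWJ : W * J = D := by
    ext v e
    simp [hW, hZ, hJ, mul_apply, rootedIncidence, hD]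
  have hJJ : Jᵀ * J = 1 := by
    ext e f
    simp [hJ, mul_apply, one_apply, eq_comm]
  have hroot : W - D * Jᵀ =
      Matrix.of fun v u => if v = r ∧ u = σ.symm none then (1 : ℝ) else 0 := by
    ext v u
    obtain ⟨o, rfl⟩ := σ.symm.surjective u
    cases o <;> simp [hW, hZ, hJ, mul_apply, rootedIncidence, hD]
  have hsingle : (W - D * Jᵀ) * Wᵀ = Matrix.single r r 1 := by
    rw [hroot]
    ext v u
    by_cases hv : v = r <;>
      simp [mul_apply, hW, hZ, rootedIncidence, Matrix.single_apply, hv, Ne.symm, eq_comm (a := r)]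
  have hfac : fromBlocks (Matrix.single r r 1) (-D) Dᵀ 0 =
      fromBlocks W (-D) 0 1 * fromBlocks 1 0 Jᵀ 1 * fromBlocks Wᵀ (-J) 0 1 := by
    rw [fromBlocks_multiply, fromBlocks_multiply]
    have h₁ : Jᵀ * Wᵀ = Dᵀ := by rw [← transpose_mul, hWJ]
    have h₂ : (W - D * Jᵀ) * J = 0 := by
      rw [Matrix.sub_mul, Matrix.mul_assoc, hJJ, hWJ, Matrix.mul_one, sub_self]
    rw [sub_eq_add_neg] at hsingle h₂
    simp [h₁, hsingle, h₂, hJJ]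
  rw [hfac, det_mul, det_mul, det_fromBlocks_zero₂₁, det_fromBlocks_zero₁₂,
    det_fromBlocks_zero₂₁, det_transpose]
  simpa using hWdet

/-- Separates the initial from the terminal edge coordinates. -/
def edgeEndEquiv (V E : Type) : (V ⊕ E) ⊕ E ≃ V ⊕ E × Bool where
  toFun := Sum.elim (Sum.elim Sum.inl fun e => Sum.inr (e, false)) fun e => Sum.inr (e, true)
  invFun := Sum.elim (fun v => Sum.inl (Sum.inl v))
    fun p => if p.2 then Sum.inr p.1 else Sum.inl (Sum.inr p.1)
  left_inv := by rintro ((v | e) | e) <;> simp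
  right_inv := by rintro (v | ⟨e, _ | _⟩) <;> simp

section Zero

variable {V E : Type} [Fintype V] [Fintype E] (ι τ : E → V)

/-- Constant functions lie in the kernel of the secular matrix at frequency zero; they remain in the
kernel after replacing a row by one which vanishes on the vertex columns. -/
theorem det_secMatrix_updateRow_eq_zero (v₀ : V) (i : V ⊕ E × Bool) (w : V ⊕ E × Bool → ℝ)
    (hw : ∀ v, w (Sum.inl v) = 0) :
    ((secMatrix ι τ ∅ 1 0).updateRow i w).det = 0 := by
  refine exists_mulVec_eq_zero_iff.mp ⟨Sum.elim 1 0, fun h => ?_, ?_⟩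
  · simpa using congrFun h (Sum.inl v₀)
  · ext j
    by_cases hj : j = i
    · subst hj
      simp [mulVec, dotProduct, hw]
    · rw [mulVec, updateRow_ne hj]
      rcases j with v | ⟨e, _ | _⟩ <;>
        simp [dotProduct, secMatrix, Finset.sum_add_distrib]

theorem det_secMatrix_one_zero (v₀ : V) : (secMatrix ι τ (∅ : Set V) 1 0).det = 0 := by
  have := det_secMatrix_updateRow_eq_zero ι τ v₀ (Sum.inl v₀)
    (secMatrix ι τ ∅ 1 0 (Sum.inl v₀)) (fun v => by simp [secMatrix])
  rwa [updateRow_eq_self] at this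

theorem adjugate_secMatrix_root (hconn : IsConnectedGraph ι τ)
    (htree : Fintype.card E + 1 = Fintype.card V) (r : V) :
    (secMatrix ι τ ∅ 1 0).adjugate (Sum.inl r) (Sum.inl r) = 1 := by
  set K := secMatrix ι τ (∅ : Set V) 1 0 with hK
  have hadd : (K.updateRow (Sum.inl r) (K (Sum.inl r) + Pi.single (Sum.inl r) 1)).det =
      K.adjugate (Sum.inl r) (Sum.inl r) := by
    rw [det_updateRow_add, updateRow_eq_self, adjugate_apply, hK, det_secMatrix_one_zero ι τ r,
      zero_add]
  set D : Matrix V E ℝ := Matrix.of fun v e =>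
    (if v = τ e then 1 else 0) - (if v = ι e then 1 else 0) with hD
  set T : Matrix V E ℝ := Matrix.of fun v e => if v = τ e then 1 else 0 with hT
  set I : Matrix V E ℝ := Matrix.of fun v e => if v = ι e then 1 else 0 with hI
  have hblocks : (K.updateRow (Sum.inl r) (K (Sum.inl r) + Pi.single (Sum.inl r) 1)).submatrix
      (edgeEndEquiv V E) (edgeEndEquiv V E) =
      fromBlocks (fromBlocks (Matrix.single r r 1) I Dᵀ 0) (fromRows T 0) (fromCols 0 1) 1 := by
    ext i j
    rcases i with (v | e) | e <;> rcases j with (u | f) | f <;>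
      simp [edgeEndEquiv, updateRow_apply, hK, secMatrix, hD, hT, hI, Matrix.single_apply,
        one_apply, Pi.single_apply, eq_comm (a := r), sub_eq_add_neg]
    all_goals grind
  rw [← hadd, ← det_submatrix_equiv_self (edgeEndEquiv V E), hblocks, det_fromBlocks_one₂₂,
    fromRows_mul_fromCols, sub_eq_add_neg, fromBlocks_neg, fromBlocks_add]
  have hDTI : I + -T = -D := by rw [← sub_eq_add_neg, ← neg_sub]; rfl
  simpa [hDTI] using det_grounded_incidence ι τ hconn htree r D fun v e => rfl

theorem adjugate_secMatrix_terminal (hconn : IsConnectedGraph ι τ)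
    (htree : Fintype.card E + 1 = Fintype.card V) (e : E) :
    (secMatrix ι τ ∅ 1 0).adjugate (Sum.inl (ι e)) (Sum.inr (e, true)) = -1 := by
  set K := secMatrix ι τ (∅ : Set V) 1 0 with hK
  have h : (K.adjugate * K) (Sum.inl (ι e)) (Sum.inr (e, false)) = 0 := by
    rw [adjugate_mul, hK, det_secMatrix_one_zero ι τ (ι e), zero_smul, Matrix.zero_apply]
  have hr := adjugate_secMatrix_root ι τ hconn htree (ι e)
  rw [← hK] at hr
  rw [mul_apply] at h
  generalize K.adjugate = B at h hr ⊢
  simp [Fintype.sum_prod_type, hK, secMatrix] at h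
  linarith

end Zero

/-- The entrywise derivative of `secMatrix` without Dirichlet vertices, in terms of the derivatives
`c'`, `s'` of the cosine and sine values. -/
noncomputable def secMatrixDeriv {V E : Type} (ι τ : E → V) (c' s' : E → ℝ) :
    Matrix (V ⊕ E × Bool) (V ⊕ E × Bool) ℝ :=
  secMatrix ι τ ∅ c' s' - secMatrix ι τ ∅ 0 0

theorem hasDerivAt_secMatrix {V E : Type} (ι τ : E → V) {c s : ℝ → E → ℝ} {c' s' : E → ℝ} {x : ℝ}
    (hc : ∀ e, HasDerivAt (fun ω => c ω e) (c' e) x)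
    (hs : ∀ e, HasDerivAt (fun ω => s ω e) (s' e) x) (i j : V ⊕ E × Bool) :
    HasDerivAt (fun ω => secMatrix ι τ ∅ (c ω) (s ω) i j) (secMatrixDeriv ι τ c' s' i j) x := by
  rcases i with v | ⟨e, _ | _⟩ <;> rcases j with u | ⟨f, _ | _⟩ <;>
    simp [secMatrixDeriv, secMatrix, hasDerivAt_const] <;> split_ifs <;>
    simp [hasDerivAt_const, hc, hs, HasDerivAt.fun_neg]

/-- On a metric tree with standard conditions, the secular function `ω ↦ det A_ω(G)` is
differentiable, vanishes at `ω = 0`, and its derivative at `ω = 0` equals `-∑ e, ℓ e`;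
in particular it has a zero of order exactly one at `ω = 0`. -/
theorem deriv_det_secA_at_zero {V E : Type} [Fintype V] [Fintype E]
    (ι τ : E → V) (hnl : ∀ e, ι e ≠ τ e)
    (hconn : IsConnectedGraph ι τ)
    (htree : Fintype.card E + 1 = Fintype.card V)
    (ℓ : E → ℝ) (hℓ : ∀ e, 0 < ℓ e) :
    Differentiable ℝ (fun ω => (secA ι τ (∅ : Set V) ℓ ω).det) ∧
    (secA ι τ (∅ : Set V) ℓ 0).det = 0 ∧
    deriv (fun ω => (secA ι τ (∅ : Set V) ℓ ω).det) 0 = -∑ e : E, ℓ e := by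
  have hder : ∀ ω, HasDerivAt (fun ω => (secA ι τ (∅ : Set V) ℓ ω).det)
      ((secA ι τ (∅ : Set V) ℓ ω).adjugate * secMatrixDeriv ι τ
        (fun e => -Real.sin (ℓ e * ω) * ℓ e) (fun e => Real.cos (ℓ e * ω) * ℓ e)).trace ω := by
    refine fun ω => hasDerivAt_det (A := secA ι τ ∅ ℓ) fun i j => ?_
    have hlin : ∀ e, HasDerivAt (fun ω => ℓ e * ω) (ℓ e) ω := fun e => by
      simpa using (hasDerivAt_id ω).const_mul (ℓ e)
    exact hasDerivAt_secMatrix ι τ (c := fun ω e => Real.cos (ℓ e * ω))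
      (s := fun ω e => Real.sin (ℓ e * ω)) (fun e => (hlin e).cos) (fun e => (hlin e).sin) i j
  obtain ⟨v₀⟩ : Nonempty V := Fintype.card_pos_iff.mp (by omega)
  have hzero : secA ι τ (∅ : Set V) ℓ 0 = secMatrix ι τ ∅ 1 0 := by
    simp [secA]; rfl
  refine ⟨fun ω => (hder ω).differentiableAt, ?_, ?_⟩
  · rw [hzero, det_secMatrix_one_zero ι τ v₀]
  · rw [(hder 0).deriv, hzero, trace_mul_comm]
    have hinit : ∀ e, (secMatrix ι τ (∅ : Set V) 1 0).adjugate (Sum.inr (e, false))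
        (Sum.inr (e, false)) = 0 := fun e => by
      rw [adjugate_apply]
      exact det_secMatrix_updateRow_eq_zero ι τ v₀ _ _ (by simp)
    have hterm := adjugate_secMatrix_terminal ι τ hconn htree
    generalize (secMatrix ι τ (∅ : Set V) 1 0).adjugate = B at hinit hterm ⊢
    simp [trace, mul_apply, Fintype.sum_prod_type, secMatrixDeriv, secMatrix, hinit, hterm]
end

section
/- Let G be a graph with edge lengths ℓ and Dirichlet set V_D, and let v ∈ V ∖ V_D. Let G⁺ be the graph obtained from G by adding one new vertex w and one new edge e* with ι(e*) = v and τ(e*) = w, of length L > 0, and impose the standard condition at w. Then for every ω ∈ ℝ: det A_ω(G⁺, V_D) = −sin(Lω) · det A_ω(G, V_D ∪ {v}) + cos(Lω) · det A_ω(G, V_D). -/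
open Matrix Filter Topology

attribute [local instance] Classical.propDecidable

/-- Determinant of a matrix bordered by the three rows and columns coming from a pendant edge
attached at the index `i`. -/
theorem det_fromBlocks_pendant {n : Type*} [Fintype n] [DecidableEq n] {R : Type*} [CommRing R]
    (A : Matrix n n R) (i : n) (c s : R) :
    (fromBlocks A (of fun a (k : Fin 3) => if a = i then ![0, 1, 0] k else 0)
      (of fun (k : Fin 3) a => if a = i then ![0, -c, s] k else 0)
      !![0, 0, 1; 1, s, 0; 0, c, 1]).det
      = -s * (A.updateRow i (Pi.single i 1)).det + c * A.det := by
  set C : Matrix (Fin 3) n R := of fun (k : Fin 3) a => if a = i then ![0, -c, s] k else 0 with hC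
  set D : Matrix (Fin 3) (Fin 3) R := !![0, 0, 1; 1, s, 0; 0, c, 1] with hD
  set M := fromBlocks A (of fun a (k : Fin 3) => if a = i then ![0, 1, 0] k else 0) C D with hM
  have hsplit : M = M.updateRow (Sum.inl i)
      (Sum.elim (A i) 0 + Sum.elim (0 : n → R) ![0, 1, 0]) := by
    ext a b
    by_cases h : a = Sum.inl i
    · subst h
      rcases b with b | b <;> simp [hM]
    · rw [updateRow_ne h]
  have hstd : (M.updateRow (Sum.inl i) (Sum.elim (A i) 0)).det = c * A.det := by
    have : M.updateRow (Sum.inl i) (Sum.elim (A i) 0) = fromBlocks A 0 C D := by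
      ext a b
      by_cases h : a = Sum.inl i
      · subst h
        rcases b with b | b <;> simp
      · rw [updateRow_ne h]
        rcases a with a | a <;> rcases b with b | b <;> simp [hM]
        have : a ≠ i := fun h' => h (by rw [h'])
        simp [this]
    rw [this, det_fromBlocks_zero₁₂, hD, det_fin_three]
    simp [mul_comm]
  have hdir : (M.updateRow (Sum.inl i) (Sum.elim (0 : n → R) ![0, 1, 0])).det
      = -s * (A.updateRow i (Pi.single i 1)).det := by
    have hprod : (M.updateRow (Sum.inl i) (Sum.elim (0 : n → R) ![0, 1, 0])).submatrix
        (Equiv.swap (Sum.inl i) (Sum.inr 2)) id =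
        fromBlocks 1 (of fun a (k : Fin 3) => if a = i then ![1, 0, c] k else 0) 0 1 *
          fromBlocks (A.updateRow i (s • Pi.single i 1)) 0
            (of fun (k : Fin 3) a => if a = i then ![0, -c, 0] k else 0)
            !![0, 0, 1; 1, s, 0; 0, 1, 0] := by
      rw [fromBlocks_multiply]
      ext a b
      rcases a with a | a
      · by_cases h : a = i
        · subst h
          rcases b with b | b
          · simp [hM, hC, mul_apply, Pi.single_apply, Fin.sum_univ_three]
          · fin_cases b <;> simp [hM, hD, mul_apply, Fin.sum_univ_three]
        · have h' : (Sum.inl a : n ⊕ Fin 3) ≠ Sum.inl i := by simpa using h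
          rw [submatrix_apply, Equiv.swap_apply_of_ne_of_ne h' (by simp), updateRow_ne h']
          rcases b with b | b <;> simp [hM, mul_apply, h]
      · fin_cases a
        · rw [submatrix_apply, Equiv.swap_apply_of_ne_of_ne (by simp) (by simp)]
          rcases b with b | b
          · simp [hM, hC]
          · fin_cases b <;> simp [hM, hD]
        · rw [submatrix_apply, Equiv.swap_apply_of_ne_of_ne (by simp) (by simp)]
          rcases b with b | b
          · simp [hM, hC]
          · fin_cases b <;> simp [hM, hD]
        · rcases b with b | b
          · simp
          · fin_cases b <;> simp
    have hdet := congrArg det hprod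
    rw [det_permute, det_mul, det_fromBlocks_zero₂₁, det_fromBlocks_zero₁₂, det_updateRow_smul,
      Equiv.Perm.sign_swap (by simp)] at hdet
    simp [det_fin_three] at hdet
    linear_combination -hdet
  rw [hsplit, det_updateRow_add, hstd, hdir, add_comm]

/-- Splits off the new vertex and the two ends of the new edge from the index set of the secular
matrix of a graph with a pendant edge attached. -/
def pendantIndexEquiv (V E : Type*) :
    (V ⊕ E × Bool) ⊕ Fin 3 ≃ (V ⊕ Unit) ⊕ (E ⊕ Unit) × Bool where
  toFun := Sum.elim (Sum.map Sum.inl (Prod.map Sum.inl id))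
    ![Sum.inl (Sum.inr ()), Sum.inr (Sum.inr (), false), Sum.inr (Sum.inr (), true)]
  invFun
    | Sum.inl (Sum.inl u) => Sum.inl (Sum.inl u)
    | Sum.inl (Sum.inr _) => Sum.inr 0
    | Sum.inr (Sum.inl e, b) => Sum.inl (Sum.inr (e, b))
    | Sum.inr (Sum.inr _, false) => Sum.inr 1
    | Sum.inr (Sum.inr _, true) => Sum.inr 2
  left_inv := by
    rintro ((u | ⟨e, b⟩) | k)
    · rfl
    · rfl
    · fin_cases k <;> rfl
  right_inv := by
    rintro ((u | u) | ⟨e | e, _ | _⟩) <;> rfl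

/-- Imposing a Dirichlet condition at `v` replaces the row of `v` by a standard basis vector. -/
theorem secA_union_singleton {V E : Type} (ι τ : E → V) (VD : Set V) (v : V) (ℓ : E → ℝ) (ω : ℝ) :
    secA ι τ (VD ∪ {v}) ℓ ω =
      (secA ι τ VD ℓ ω).updateRow (Sum.inl v) (Pi.single (Sum.inl v) 1) := by
  ext a b
  by_cases h : a = Sum.inl v
  · subst h
    rcases b with b | ⟨f, b⟩ <;> simp [secA, secMatrix, Pi.single_apply]
  · rw [updateRow_ne h]
    rcases a with a | ⟨e, a⟩
    · have h' : a ≠ v := fun h' => h (by rw [h'])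
      rcases b with b | ⟨f, b⟩ <;> simp [secA, secMatrix, h']
    · rcases b with b | b <;> simp [secA, secMatrix]

/-- Block form of the secular matrix of a graph with a pendant edge attached at `v`. -/
theorem secA_attach_pendant_submatrix {V E : Type} (ι τ : E → V) (ℓ : E → ℝ)
    (VD : Set V) (v : V) (hv : v ∉ VD) (L ω : ℝ) :
    (secA
      (Sum.elim (fun e : E => (Sum.inl (ι e) : V ⊕ Unit)) (fun _ : Unit => Sum.inl v))
      (Sum.elim (fun e : E => (Sum.inl (τ e) : V ⊕ Unit)) (fun _ : Unit => Sum.inr ()))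
      (Sum.inl '' VD)
      (Sum.elim ℓ (fun _ : Unit => L)) ω).submatrix
        (pendantIndexEquiv V E) (pendantIndexEquiv V E) =
      fromBlocks (secA ι τ VD ℓ ω)
        (of fun a (k : Fin 3) => if a = Sum.inl v then ![0, 1, 0] k else 0)
        (of fun (k : Fin 3) a =>
          if a = Sum.inl v then ![0, -Real.cos (L * ω), Real.sin (L * ω)] k else 0)
        !![0, 0, 1; 1, Real.sin (L * ω), 0; 0, Real.cos (L * ω), 1] := by
  ext a b
  rcases a with (a | ⟨e, a⟩) | a <;> rcases b with (b | ⟨f, b⟩) | b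
  · simp [pendantIndexEquiv, secA, secMatrix]
  · simp [pendantIndexEquiv, secA, secMatrix]
  · by_cases h : a = v
    · subst h
      fin_cases b <;> simp [pendantIndexEquiv, secA, secMatrix, hv]
    · fin_cases b <;> simp [pendantIndexEquiv, secA, secMatrix, h, Ne.symm h]
  · simp [pendantIndexEquiv, secA, secMatrix]
  · simp [pendantIndexEquiv, secA, secMatrix]
  · fin_cases b <;> simp [pendantIndexEquiv, secA, secMatrix]
  · fin_cases a <;> simp [pendantIndexEquiv, secA, secMatrix]
  · fin_cases a <;> simp [pendantIndexEquiv, secA, secMatrix]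
  · fin_cases a <;> fin_cases b <;> simp [pendantIndexEquiv, secA, secMatrix]

/-- Attaching a pendant edge of length `L` at a standard vertex `v`, with standard
conditions at the new vertex `Sum.inr ()`:
`det A_ω(G⁺, V_D) = -sin(Lω) det A_ω(G, V_D ∪ {v}) + cos(Lω) det A_ω(G, V_D)`. -/
theorem det_secA_attach_pendant_standard {V E : Type} [Fintype V] [Fintype E]
    (ι τ : E → V) (hnl : ∀ e, ι e ≠ τ e)
    (ℓ : E → ℝ) (hℓ : ∀ e, 0 < ℓ e)
    (VD : Set V) (v : V) (hv : v ∉ VD) (L : ℝ) (hL : 0 < L) (ω : ℝ) :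
    (secA
      (Sum.elim (fun e : E => (Sum.inl (ι e) : V ⊕ Unit)) (fun _ : Unit => Sum.inl v))
      (Sum.elim (fun e : E => (Sum.inl (τ e) : V ⊕ Unit)) (fun _ : Unit => Sum.inr ()))
      (Sum.inl '' VD)
      (Sum.elim ℓ (fun _ : Unit => L)) ω).det
      = -Real.sin (L * ω) * (secA ι τ (VD ∪ {v}) ℓ ω).det
        + Real.cos (L * ω) * (secA ι τ VD ℓ ω).det := by
  rw [← det_submatrix_equiv_self (pendantIndexEquiv V E),
    secA_attach_pendant_submatrix ι τ ℓ VD v hv L ω, det_fromBlocks_pendant,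
    secA_union_singleton]
end

section
/- Let G₁, …, G_n (n ≥ 2) be graphs with pairwise disjoint vertex and edge sets and with edge lengths, and fix a vertex v_i in each G_i. Let G be the graph obtained by identifying v₁, …, v_n to a single vertex v, i.e. the vertex set of G is {v} ∪ ⋃_i (V(G_i) ∖ {v_i}), the edge set of G is the disjoint union ⋃_i E(G_i) with unchanged lengths, and every edge endpoint equal to some v_i becomes v. Then for every ω ∈ ℝ: det A_ω(G, {v}) = ∏_{i=1}^n det A_ω(G_i, {v_i}), where the Dirichlet set consists of the single vertex v (respectively v_i) and all other vertices carry standard conditions. -/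
open Matrix Filter Topology

attribute [local instance] Classical.propDecidable

/-- A row with a single nonzero entry, equal to `1` and on the diagonal, can be deleted together
with the corresponding column without changing the determinant. -/
theorem det_eq_det_submatrix_of_row_single {R m k : Type*} [CommRing R] [Fintype m] [DecidableEq m]
    [Fintype k] [DecidableEq k] (M : Matrix k k R) (a : k) (f : m → k)
    (hf : Function.Injective f) (hrange : ∀ x, x ≠ a ↔ x ∈ Set.range f)
    (hrow : ∀ x, M a x = if x = a then 1 else 0) :
    M.det = (M.submatrix f f).det := by
  have hfa : ∀ y, f y ≠ a := fun y => (hrange _).2 ⟨y, rfl⟩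
  let g : Unit ⊕ m → k := Sum.elim (fun _ => a) f
  have hg : Function.Bijective g := by
    constructor
    · rintro (x | x) (y | y) h
      · rfl
      · exact absurd h.symm (hfa y)
      · exact absurd h (hfa x)
      · exact congrArg Sum.inr (hf h)
    · intro x
      by_cases hx : x = a
      · exact ⟨Sum.inl (), hx.symm⟩
      · obtain ⟨y, rfl⟩ := (hrange x).1 hx
        exact ⟨Sum.inr y, rfl⟩
  rw [← det_submatrix_equiv_self (Equiv.ofBijective g hg) M,
    ← fromBlocks_toBlocks (M.submatrix _ _)]
  have h12 : (M.submatrix (Equiv.ofBijective g hg) (Equiv.ofBijective g hg)).toBlocks₁₂ = 0 := by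
    ext i j
    simp [toBlocks₁₂, g, hrow, hfa]
  rw [h12, det_fromBlocks_zero₁₂]
  have h11 : (M.submatrix (Equiv.ofBijective g hg) (Equiv.ofBijective g hg)).toBlocks₁₁ = 1 := by
    ext i j
    simp [toBlocks₁₁, g, hrow]
  rw [h11, det_one, one_mul]
  rfl

/-- The determinant of a block diagonal matrix with blocks of varying sizes. -/
theorem det_blockDiagonal'_eq_prod {R : Type*} [CommRing R] {n : ℕ} {m : Fin n → Type*}
    [∀ i, Fintype (m i)] [∀ i, DecidableEq (m i)] (M : ∀ i, Matrix (m i) (m i) R) :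
    (blockDiagonal' M).det = ∏ i, (M i).det := by
  rw [(blockTriangular_blockDiagonal' M).det_fintype]
  refine Finset.prod_congr rfl fun i _ => ?_
  let e : m i ≃ {a : Σ i, m i // a.1 = i} :=
    (Equiv.sigmaSubtype i).symm
  rw [← det_submatrix_equiv_self e]
  congr 1
  ext x y
  simp [e, toSquareBlock_def, Equiv.sigmaSubtype]

/-- The rows and columns of the secular matrix of `G` away from a vertex `v`. -/
def offVertex {V E : Type} (v : V) : {u : V // u ≠ v} ⊕ E × Bool → V ⊕ E × Bool :=
  Sum.map Subtype.val id

/-- The secular determinant with a single Dirichlet vertex is the minor away from it. -/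
theorem det_secA_singleton {V E : Type} [Fintype V] [Fintype E] (ι τ : E → V) (v : V)
    (ℓ : E → ℝ) (ω : ℝ) :
    (secA ι τ {v} ℓ ω).det =
      ((secA ι τ {v} ℓ ω).submatrix (offVertex v) (offVertex v)).det := by
  apply det_eq_det_submatrix_of_row_single _ (Sum.inl v)
  · exact Sum.map_injective.2 ⟨Subtype.val_injective, Function.injective_id⟩
  · rintro (x | x) <;> simp [offVertex]
  · rintro (x | ⟨x, b⟩) <;> simp [secA, secMatrix]

/-- The rows and columns of the glued graph away from the gluing vertex. -/
def glueOffVertex {I : Type} {V E : I → Type} (v : ∀ i, V i) :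
    (Σ i, {u : V i // u ≠ v i} ⊕ E i × Bool) →
      (Unit ⊕ Σ i, {u : V i // u ≠ v i}) ⊕ (Σ i, E i) × Bool
  | ⟨i, Sum.inl u⟩ => Sum.inl (Sum.inr ⟨i, u⟩)
  | ⟨i, Sum.inr (e, b)⟩ => Sum.inr (⟨i, e⟩, b)

/-- Gluing graphs `G₁, …, G_n` (`n ≥ 2`) at chosen vertices `v i`, identified to a single
vertex `Sum.inl ()` which carries a Dirichlet condition (standard conditions elsewhere):
the secular determinant of the glued graph factorizes,
`det A_ω(G, {v}) = ∏ i, det A_ω(G i, {v i})`. -/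
theorem det_secA_glue_dirichlet {n : ℕ} (hn : 2 ≤ n)
    (V E : Fin n → Type) [∀ i, Fintype (V i)] [∀ i, Fintype (E i)]
    (ι τ : ∀ i, E i → V i) (hnl : ∀ i e, ι i e ≠ τ i e)
    (ℓ : ∀ i, E i → ℝ) (hℓ : ∀ i e, 0 < ℓ i e)
    (v : ∀ i, V i) (ω : ℝ) :
    (secA
      (fun e : Σ i, E i =>
        if h : ι e.1 e.2 = v e.1 then (Sum.inl () : Unit ⊕ Σ i, {u : V i // u ≠ v i})
        else Sum.inr ⟨e.1, ι e.1 e.2, h⟩)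
      (fun e : Σ i, E i =>
        if h : τ e.1 e.2 = v e.1 then (Sum.inl () : Unit ⊕ Σ i, {u : V i // u ≠ v i})
        else Sum.inr ⟨e.1, τ e.1 e.2, h⟩)
      ({Sum.inl ()} : Set (Unit ⊕ Σ i, {u : V i // u ≠ v i}))
      (fun e => ℓ e.1 e.2) ω).det
      = ∏ i : Fin n, (secA (ι i) (τ i) ({v i} : Set (V i)) (ℓ i) ω).det := by
  rw [det_eq_det_submatrix_of_row_single _ (Sum.inl (Sum.inl ())) (glueOffVertex v)]
  · simp only [det_secA_singleton]
    rw [← det_blockDiagonal'_eq_prod]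
    congr 1
    ext ⟨i, x⟩ ⟨j, y⟩
    rw [blockDiagonal'_apply]
    split_ifs with hij
    · obtain rfl : i = j := hij
      rcases x with x | ⟨e, b⟩ <;> rcases y with y | ⟨f, b'⟩
      · simp [secA, secMatrix, glueOffVertex, offVertex, x.2]
      · have hx := x.2
        by_cases h1 : ι i f = v i <;> by_cases h2 : τ i f = v i <;>
          cases b' <;>
          simp [secA, secMatrix, glueOffVertex, offVertex, h1, h2, hx, hx.symm, Subtype.ext_iff]
      · have hy := y.2
        by_cases h1 : ι i e = v i <;> by_cases h2 : τ i e = v i <;>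
          cases b <;>
          simp [secA, secMatrix, glueOffVertex, offVertex, h1, h2, hy, Subtype.ext_iff]
      · cases b <;> cases b' <;> simp [secA, secMatrix, glueOffVertex, offVertex]
    · have hji : j ≠ i := fun h => hij h.symm
      rcases x with x | ⟨e, b⟩ <;> rcases y with y | ⟨f, b'⟩
      · simp [secA, secMatrix, glueOffVertex]
      · by_cases h1 : ι j f = v j <;> by_cases h2 : τ j f = v j <;>
          cases b' <;> simp [secA, secMatrix, glueOffVertex, h1, h2, hji]
      · by_cases h1 : ι i e = v i <;> by_cases h2 : τ i e = v i <;>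
          cases b <;> simp [secA, secMatrix, glueOffVertex, h1, h2, hji]
      · cases b <;> cases b' <;> simp [secA, secMatrix, glueOffVertex, hji]
  · rintro ⟨i, x | ⟨e, b⟩⟩ ⟨j, y | ⟨f, b'⟩⟩ h <;> simp [glueOffVertex] at h
    · obtain ⟨rfl, h⟩ := h
      simpa using h
    · obtain ⟨⟨rfl, h⟩, rfl⟩ := h
      simpa using h
  · rintro ((x | ⟨i, x⟩) | ⟨⟨i, e⟩, b⟩)
    · simp [glueOffVertex]
    · exact iff_of_true (by simp) ⟨⟨i, Sum.inl x⟩, rfl⟩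
    · exact iff_of_true (by simp) ⟨⟨i, Sum.inr (e, b)⟩, rfl⟩
  · rintro ((x | x) | ⟨e, b⟩) <;> simp [secA, secMatrix]
end

section
/- Let G be a tree with edge lengths ℓ and let v be a vertex of G of degree one. Impose the Dirichlet condition at v and standard conditions at all other vertices, i.e. V_D = {v}. Then det A_0(G, {v}) = 1. -/
open Matrix Filter Topology

attribute [local instance] Classical.propDecidable

/-- The oriented incidence matrix of a graph, with rows indexed by vertices. -/
noncomputable def orientedIncidence {V E : Type} (ι τ : E → V) : Matrix V E ℤ :=
  Matrix.of fun u e => (if ι e = u then 1 else 0) - (if τ e = u then 1 else 0)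

/-- If `u` and `w` are joined by a walk, then `u - w` is in the image of the boundary map. -/
theorem exists_orientedIncidence_mulVec_eq {V E : Type} [Fintype E] (ι τ : E → V) {u w : V}
    (h : Relation.ReflTransGen (GraphAdj ι τ) u w) :
    ∃ x : E → ℤ, orientedIncidence ι τ *ᵥ x = Pi.single u 1 - Pi.single w 1 := by
  induction h with
  | refl => exact ⟨0, by simp⟩
  | @tail b c _ hbc ih =>
    obtain ⟨x, hx⟩ := ih
    obtain ⟨e, h | h⟩ := hbc
    · refine ⟨x + Pi.single e 1, ?_⟩
      rw [Matrix.mulVec_add, hx]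
      ext z
      simp [orientedIncidence, h.1, h.2, Pi.single_apply, eq_comm (a := z)]
    · refine ⟨x - Pi.single e 1, ?_⟩
      rw [Matrix.mulVec_sub, hx]
      ext z
      simp [orientedIncidence, h.1, h.2, Pi.single_apply, eq_comm (a := z)]

/-- A square reduced incidence matrix of a connected graph is unimodular. -/
theorem isUnit_det_reduced_orientedIncidence {V E : Type} [Fintype E] (ι τ : E → V)
    (hconn : IsConnectedGraph ι τ) (v : V) (φ : E → V) (hφ : Function.Injective φ)
    (hv : ∀ e, φ e ≠ v) :
    IsUnit ((orientedIncidence ι τ).submatrix φ id).det := by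
  choose x hx using fun e => exists_orientedIncidence_mulVec_eq ι τ (hconn (φ e) v)
  refine Matrix.isUnit_det_of_right_inverse (B := Matrix.of fun e e' => x e' e) ?_
  ext e e'
  have := congrFun (hx e') (φ e)
  simp only [Matrix.mulVec, dotProduct, Pi.sub_apply, Pi.single_apply, hv e, if_false,
    hφ.eq_iff, sub_zero] at this
  simpa [Matrix.mul_apply, Matrix.one_apply] using this

theorem det_fromBlocks_zero_one_neg_one_zero {n R : Type*} [Fintype n] [DecidableEq n]
    [CommRing R] : (fromBlocks 0 1 (-1) 0 : Matrix (n ⊕ n) (n ⊕ n) R).det = 1 := by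
  have : (fromBlocks 0 1 (-1) 0 : Matrix (n ⊕ n) (n ⊕ n) R) =
      fromBlocks 1 1 0 1 * fromBlocks 1 0 (-1) 1 * fromBlocks 1 1 0 1 := by
    simp [fromBlocks_multiply]
  simp [this]

theorem det_fromBlocks_zero_neg_transpose_zero {n R : Type*} [Fintype n] [DecidableEq n]
    [CommRing R] (B : Matrix n n R) : (fromBlocks 0 B (-Bᵀ) 0).det = B.det ^ 2 := by
  have : fromBlocks 0 B (-Bᵀ) 0 = fromBlocks B 0 0 Bᵀ * fromBlocks 0 1 (-1) 0 := by
    simp [fromBlocks_multiply]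
  rw [this, det_mul, det_fromBlocks_zero_one_neg_one_zero, det_fromBlocks_zero₂₁,
    det_transpose, mul_one, sq]

/-- At `ω = 0`, the secular determinant with one Dirichlet vertex is the square of a reduced
incidence determinant, when the edges are in bijection with the remaining vertices. -/
theorem det_secA_zero_eq_sq {V E : Type} [Fintype V] [Fintype E] (ι τ : E → V) (ℓ : E → ℝ)
    (v : V) (φ : E ≃ {u // u ≠ v}) :
    (secA ι τ ({v} : Set V) ℓ 0).det =
      (((orientedIncidence ι τ).submatrix (fun e => (φ e : V)) id).map
        (Int.cast : ℤ → ℝ)).det ^ 2 := by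
  let f : ((E ⊕ E) ⊕ E) ⊕ Unit → V ⊕ E × Bool :=
    Sum.elim (Sum.elim (Sum.elim (fun e => Sum.inl (φ e)) fun e => Sum.inr (e, false))
      fun e => Sum.inr (e, true)) fun _ => Sum.inl v
  have hf : Function.Bijective f := by
    constructor
    · rintro (((a | a) | a) | a) (((b | b) | b) | b) h <;>
        simp_all [f, Subtype.coe_inj, (φ _).2, (φ _).2.symm]
    · rintro (u | ⟨e, _ | _⟩)
      · by_cases h : u = v
        · exact ⟨Sum.inr (), by simp [f, h]⟩
        · exact ⟨Sum.inl (Sum.inl (Sum.inl (φ.symm ⟨u, h⟩))), by simp [f]⟩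
      · exact ⟨Sum.inl (Sum.inl (Sum.inr e)), rfl⟩
      · exact ⟨Sum.inl (Sum.inr e), rfl⟩
  let I : Matrix E E ℝ := Matrix.of fun e' e => if ι e = φ e' then 1 else 0
  let J : Matrix E E ℝ := Matrix.of fun e' e => if τ e = φ e' then 1 else 0
  let c : Matrix ((E ⊕ E) ⊕ E) Unit ℝ :=
    Matrix.of fun i j => secA ι τ ({v} : Set V) ℓ 0 (f (Sum.inl i)) (f (Sum.inr j))
  have hφ (e : E) (u : V) : (φ e : V) = u ↔ u = φ e := eq_comm
  have hM : (secA ι τ ({v} : Set V) ℓ 0).submatrix f f =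
      fromBlocks (fromBlocks (fromBlocks 0 I (-(I - J)ᵀ) 0) (fromRows J 0)
        (fromCols 0 1) 1) c 0 1 := by
    ext (((a | a) | a) | a) (((b | b) | b) | b) <;>
      simp [f, I, J, c, secA, secMatrix, (φ _).2, Matrix.one_apply, eq_comm (a := b), hφ]
    split_ifs <;> simp
  have hB : (((orientedIncidence ι τ).submatrix (fun e => (φ e : V)) id).map
      (Int.cast : ℤ → ℝ)) = I - J := by
    ext a b
    simp [orientedIncidence, I, J]
  rw [← det_submatrix_equiv_self (Equiv.ofBijective f hf), Equiv.coe_ofBijective, hM,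
    det_fromBlocks_zero₂₁, det_one, mul_one, det_fromBlocks_one₂₂, hB,
    ← det_fromBlocks_zero_neg_transpose_zero]
  congr 1
  rw [fromRows_mul_fromCols]
  ext (a | a) (b | b) <;> simp


/-- On a metric tree with a Dirichlet condition at a single vertex `v` of degree one and
standard conditions elsewhere, `det A₀(G, {v}) = 1`. -/
theorem det_secA_zero_tree_dirichlet_leaf {V E : Type} [Fintype V] [Fintype E]
    (ι τ : E → V) (hnl : ∀ e, ι e ≠ τ e)
    (hconn : IsConnectedGraph ι τ)
    (htree : Fintype.card E + 1 = Fintype.card V)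
    (ℓ : E → ℝ) (hℓ : ∀ e, 0 < ℓ e)
    (v : V) (hdeg : graphDegree ι τ v = 1) :
    (secA ι τ ({v} : Set V) ℓ 0).det = 1 := by
  obtain ⟨φ⟩ : Nonempty (E ≃ {u // u ≠ v}) := by
    rw [← Fintype.card_eq, Fintype.card_subtype_compl, Fintype.card_subtype_eq]
    omega
  rw [det_secA_zero_eq_sq ι τ ℓ v φ]
  have h := isUnit_det_reduced_orientedIncidence ι τ hconn v (fun e => (φ e : V))
    (Subtype.val_injective.comp φ.injective) fun e => (φ e).2
  rw [← Int.cast_det]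
  exact_mod_cast Int.isUnit_sq h
end
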